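/- arXiv:1606.06819 — 3 statements merged into one kernel-verified Lean document; each statement's English description precedes it below -/
import Mathlib

section
/- In Twyst-off, if (a,b,c) is a P position with a > 0, then c < a + b. -/
namespace TwystOff

/-- Contraction: merge the two neighbors of an interior zero stack; delete empty end stacks. -/
def contract : List ℕ → List ℕ
  | [] => []
  | a :: t =>
    if a = 0 then contract t
    else match t with
      | [] => [a]
      | [b] => if b = 0 then [a] else [a, b]
      | b :: c :: r => if b = 0 then contract ((a + c) :: r) else a :: contract (b :: c :: r)
termination_by l => l.length

theorem contract_sum (l : List ℕ) : (contract l).sum = l.sum := by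
  induction l using contract.induct <;> rw [contract.eq_def] <;> simp_all <;> omega

/-- A raw move: remove `k > 0` tiles from an end stack, or `k` tiles from each of two
consecutive stacks; the result is then contracted. -/
def premove (p q : List ℕ) : Prop :=
  (∃ a t k, p = a :: t ∧ 0 < k ∧ k ≤ a ∧ q = contract ((a - k) :: t)) ∨
  (∃ a t k, p = t ++ [a] ∧ 0 < k ∧ k ≤ a ∧ q = contract (t ++ [a - k])) ∨
  (∃ α a b β k, p = α ++ a :: b :: β ∧ 0 < k ∧ k ≤ a ∧ k ≤ b ∧
      q = contract (α ++ (a - k) :: (b - k) :: β))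

/-- Moves of Twyst-off (positions are considered up to contraction). -/
def Move (p q : List ℕ) : Prop := premove (contract p) q

theorem Move.sum_lt {p q : List ℕ} (h : Move p q) : q.sum < p.sum := by
  rw [← contract_sum p]
  rcases h with ⟨a, t, k, hp, hk, hka, hq⟩ | ⟨a, t, k, hp, hk, hka, hq⟩ |
    ⟨α, a, b, β, k, hp, hk, hka, hkb, hq⟩ <;>
    subst hq <;> rw [contract_sum, hp] <;> simp [List.sum_append] <;> omega

/-- P positions: every option is an N position (i.e. no option is itself P). -/
def PPos (p : List ℕ) : Prop := ∀ q, Move p q → ¬ PPos q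
termination_by p.sum
decreasing_by exact Move.sum_lt (by assumption)

/-- N positions: some option is a P position. -/
def NPos (p : List ℕ) : Prop := ∃ q, Move p q ∧ PPos q

end TwystOff


namespace TwystOff

section Abstract

variable {P : ℕ → ℕ → ℕ → Prop}

/-- Winning moves from an `N` position with three nonempty stacks. -/
def HasWin (P : ℕ → ℕ → ℕ → Prop) : Prop :=
  ∀ a b c, 0 < a → 0 < b → 0 < c → ¬ P a b c →
    (∃ c', c' < c ∧ P a b c') ∨ (∃ a', a' < a ∧ P a' b c) ∨
    (∃ j, 0 < j ∧ j ≤ b ∧ j ≤ c ∧ P a (b - j) (c - j)) ∨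
    (∃ j, 0 < j ∧ j ≤ a ∧ j ≤ b ∧ P (a - j) (b - j) c)

/-- From `(x,y,x)`, up to symmetry there are only two kinds of winning moves. -/
theorem win_mirror (hsym : ∀ a b c, P a b c → P c b a) (hN : HasWin P)
    (x y : ℕ) (hx : 0 < x) (hy : 0 < y) (h : ¬ P x y x) :
    (∃ w, w < x ∧ P w y x) ∨ (∃ j, 0 < j ∧ j ≤ y ∧ j ≤ x ∧ P (x - j) (y - j) x) := by
  rcases hN x y x hx hy hx h with ⟨c, hc, h⟩ | ⟨c, hc, h⟩ | ⟨j, h1, h2, h3, h⟩ | ⟨j, h1, h2, h3, h⟩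
  · exact Or.inl ⟨c, hc, hsym _ _ _ h⟩
  · exact Or.inl ⟨c, hc, h⟩
  · exact Or.inr ⟨j, h1, h2, h3, hsym _ _ _ h⟩
  · exact Or.inr ⟨j, h1, h3, h2, h⟩

theorem chainA (hsym : ∀ a b c, P a b c → P c b a)
    (hu : ∀ a b c c', P a b c → P a b c' → c = c')
    (h0 : ∀ a c, P a 0 c → a = 0) (hN : HasWin P) :
    ∀ n x1 y1 c1 x2 y2 c2, c1 + c2 ≤ n → P x1 y1 c1 → P x2 y2 c2 → x1 < c1 → x2 < c2 →
      x1 + y2 = x2 + y1 → c1 = c2 ∨ c1 ≤ x2 ∨ c2 ≤ x1 := by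
  have pred : ∀ x y c, P x y c → x < c → 0 < x →
      ∃ x' y', P x' y' x ∧ x' < x ∧ x' + y = x + y' := by
    intro x y c h hxc hx
    have hy : 0 < y := by
      rcases Nat.eq_zero_or_pos y with rfl | hy
      · have := h0 _ _ h; omega
      · exact hy
    have hn : ¬ P x y x := fun h' => by have := hu _ _ _ _ h h'; omega
    rcases win_mirror hsym hN x y hx hy hn with ⟨w, hw, h'⟩ | ⟨j, h1, h2, h3, h'⟩
    · have := hu _ _ _ _ h (hsym _ _ _ h'); omega
    · exact ⟨x - j, y - j, h', by omega, by omega⟩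
  intro n
  induction n with
  | zero => intros; omega
  | succ n ih =>
    intro x1 y1 c1 x2 y2 c2 hn h1 h2 l1 l2 hd
    rcases lt_trichotomy x1 x2 with h | h | h
    · obtain ⟨x3, y3, h3, l3, hd3⟩ := pred x2 y2 c2 h2 l2 (by omega)
      have := ih x1 y1 c1 x3 y3 x2 (by omega) h1 h3 l1 l3 (by omega)
      omega
    · obtain rfl : y1 = y2 := by omega
      subst h
      exact Or.inl (hu _ _ _ _ h1 h2)
    · obtain ⟨x3, y3, h3, l3, hd3⟩ := pred x1 y1 c1 h1 l1 (by omega)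
      have := ih x3 y3 x1 x2 y2 c2 (by omega) h3 h2 l3 l2 (by omega)
      omega

theorem chainB (hsym : ∀ a b c, P a b c → P c b a)
    (hd : ∀ a b c b' c', P a b c → P a b' c' → c + b' = c' + b → b = b')
    (hN : HasWin P) (N : ℕ)
    (IH : ∀ a b c, a + b + c < N → 0 < a → P a b c → c < a + b) :
    ∀ n x1 y1 c1 x2 y2 c2, c1 + c2 ≤ n → x1 + y1 + c1 < N → x2 + y2 + c2 < N →
      P x1 y1 c1 → P x2 y2 c2 → x1 < c1 → x2 < c2 →
      c1 + y2 = c2 + y1 → c1 = c2 ∨ c1 ≤ x2 ∨ c2 ≤ x1 := by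
  have pred : ∀ x y c, x + y + c < N → P x y c → x < c → 0 < x →
      ∃ x' y', P x' y' x ∧ x' < x ∧ c + y' = x + y ∧ x' + y' + x < N := by
    intro x y c hs h hxc hx
    have hy := IH x y c hs hx h
    have hn : ¬ P x (x + y - c) x := fun h' => by
      have := hd _ _ _ _ _ h h' (by omega); omega
    rcases win_mirror hsym hN x (x + y - c) hx (by omega) hn with
      ⟨w, hw, h'⟩ | ⟨j, h1, h2, h3, h'⟩
    · exact ⟨w, x + y - c, h', hw, by omega, by omega⟩
    · have := hd _ _ _ _ _ h (hsym _ _ _ h') (by omega); omega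
  intro n
  induction n with
  | zero => intros; omega
  | succ n ih =>
    intro x1 y1 c1 x2 y2 c2 hn s1 s2 h1 h2 l1 l2 hdd
    rcases lt_trichotomy x1 x2 with h | h | h
    · obtain ⟨x3, y3, h3, l3, hd3, s3⟩ := pred x2 y2 c2 s2 h2 l2 (by omega)
      have := ih x1 y1 c1 x3 y3 x2 (by omega) s1 s3 h1 h3 l1 l3 (by omega)
      omega
    · subst h
      have := hd _ _ _ _ _ h1 h2 hdd
      omega
    · obtain ⟨x3, y3, h3, l3, hd3, s3⟩ := pred x1 y1 c1 s1 h1 l1 (by omega)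
      have := ih x3 y3 x1 x2 y2 c2 (by omega) s3 s2 h3 h2 l3 l2 (by omega)
      omega

theorem abstract_main (hsym : ∀ a b c, P a b c → P c b a)
    (hu : ∀ a b c c', P a b c → P a b c' → c = c')
    (hd : ∀ a b c b' c', P a b c → P a b' c' → c + b' = c' + b → b = b')
    (h0 : ∀ a c, P a 0 c → a = 0) (hN : HasWin P) :
    ∀ N a b c, a + b + c < N → 0 < a → P a b c → c < a + b := by
  intro N
  induction N with
  | zero => intros; omega
  | succ N IH =>
    intro a b c hs ha h
    by_contra hlt
    have hb : 0 < b := by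
      rcases Nat.eq_zero_or_pos b with rfl | hb
      · have := h0 _ _ h; omega
      · exact hb
    have noc : ∀ e, e < c → ¬ P a b e := fun e he h' => by
      have := hu _ _ _ _ h h'; omega
    have key : ∀ i, i < b → ∃ j, 0 < j ∧ j ≤ b ∧ j ≤ a + i ∧ P a (b - j) (a + i - j) := by
      intro i hi
      rcases hN a b (a + i) ha hb (by omega) (noc _ (by omega)) with
        ⟨e, he, h'⟩ | ⟨x, hx, h'⟩ | h' | ⟨j, h1, h2, h3, h'⟩
      · exact absurd h' (noc _ (by omega))
      · rcases Nat.eq_zero_or_pos i with rfl | hi0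
        · exact absurd (hsym _ _ _ h') (noc _ (by omega))
        · by_cases hp : P a (b - i) a
          · exact ⟨i, hi0, by omega, by omega, by simpa using hp⟩
          · rcases win_mirror hsym hN a (b - i) ha (by omega) hp with
              ⟨w, hw, h2⟩ | ⟨j, h1, h2, h3, h4⟩
            · have := chainB hsym hd hN N IH _ x b (a + i) w (b - i) a le_rfl (by omega)
                (by omega) h' h2 (by omega) hw (by omega)
              omega
            · refine ⟨i + j, by omega, by omega, by omega, ?_⟩
              have e1 : b - (i + j) = b - i - j := by omega
              have e2 : a + i - (i + j) = a - j := by omega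
              rw [e1, e2]
              exact hsym _ _ _ h4
      · exact h'
      · rcases Nat.eq_zero_or_pos i with rfl | hi0
        · exact ⟨j, h1, h3, by omega, by simpa using hsym _ _ _ h'⟩
        · rcases win_mirror hsym hN a b ha hb (noc _ (by omega)) with
            ⟨w, hw, h4⟩ | ⟨k, k1, k2, k3, h4⟩
          · exact absurd (hsym _ _ _ h4) (noc _ (by omega))
          · have := chainA hsym hu h0 hN _ (a - k) (b - k) a (a - j) (b - j) (a + i) le_rfl
              h4 h' (by omega) (by omega) (by omega)
            omega
    choose! f hf using key
    have hmaps : ∀ i ∈ Finset.range b, f i ∈ Finset.Ico 1 b := by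
      intro i hi
      obtain ⟨h1, h2, h3, h4⟩ := hf i (Finset.mem_range.1 hi)
      rw [Finset.mem_Ico]
      refine ⟨h1, lt_of_le_of_ne h2 fun he => ?_⟩
      rw [he, Nat.sub_self] at h4
      have := h0 _ _ h4
      omega
    obtain ⟨i, hi, i', hi', hne, heq⟩ :=
      Finset.exists_ne_map_eq_of_card_lt_of_maps_to (by simp; omega) hmaps
    obtain ⟨h1, h2, h3, h4⟩ := hf i (Finset.mem_range.1 hi)
    obtain ⟨k1, k2, k3, k4⟩ := hf i' (Finset.mem_range.1 hi')
    rw [← heq] at k4 k3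
    have := hu _ _ _ _ h4 k4
    omega

end Abstract

theorem ppos_iff (p : List ℕ) : PPos p ↔ ∀ q, Move p q → ¬ PPos q := by
  rw [PPos]

theorem ppos_congr {p q : List ℕ} (h : contract p = contract q) : PPos p ↔ PPos q := by
  rw [ppos_iff p, ppos_iff q]
  unfold Move
  rw [h]

theorem contract3 (a b c : ℕ) : contract (contract [a, b, c]) = contract [a, b, c] := by
  by_cases ha : a = 0 <;> by_cases hb : b = 0 <;> by_cases hc : c = 0 <;>
    simp [contract, ha, hb, hc]

theorem ppos_contract3 (a b c : ℕ) : PPos (contract [a, b, c]) ↔ PPos [a, b, c] :=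
  ppos_congr (contract3 a b c)

theorem not_of_move {a b c a' b' c' : ℕ} (h : PPos [a, b, c])
    (hm : Move [a, b, c] (contract [a', b', c'])) : ¬ PPos [a', b', c'] := by
  rw [← ppos_contract3]
  exact (ppos_iff _).1 h _ hm

theorem move_c (a b c c' : ℕ) (h : c' < c) : Move [a, b, c] (contract [a, b, c']) := by
  have e : c - (c - c') = c' := by omega
  unfold Move
  by_cases ha : a = 0 <;> by_cases hb : b = 0
  · refine Or.inr (Or.inl ⟨c, [], c - c', ?_, by omega, by omega, ?_⟩) <;>
      simp [contract, ha, hb, e]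
    omega
  · refine Or.inr (Or.inl ⟨c, [b], c - c', ?_, by omega, by omega, ?_⟩) <;>
      simp [contract, ha, hb, e]
    omega
  · refine Or.inr (Or.inl ⟨a + c, [], c - c', ?_, by omega, by omega, ?_⟩)
    · simp [contract, ha, hb]
    · have e2 : a + c - (c - c') = a + c' := by omega
      simp [contract, ha, hb, e2]
  · refine Or.inr (Or.inl ⟨c, [a, b], c - c', ?_, by omega, by omega, ?_⟩) <;>
      simp [contract, ha, hb, e]
    omega

theorem move_d (a b c j : ℕ) (h : 0 < j) : Move [a, b + j, c + j] (contract [a, b, c]) := by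
  unfold Move
  by_cases ha : a = 0
  · refine Or.inr (Or.inr ⟨[], b + j, c + j, [], j, ?_, h, by omega, by omega, ?_⟩) <;>
      simp [contract, ha, h.ne']
  · refine Or.inr (Or.inr ⟨[a], b + j, c + j, [], j, ?_, h, by omega, by omega, ?_⟩) <;>
      simp [contract, ha, h.ne']

theorem move3 (a b c : ℕ) (ha : 0 < a) (hb : 0 < b) (hc : 0 < c) (q : List ℕ)
    (h : Move [a, b, c] q) :
    (∃ c', c' < c ∧ q = contract [a, b, c']) ∨ (∃ a', a' < a ∧ q = contract [a', b, c]) ∨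
    (∃ j, 0 < j ∧ j ≤ b ∧ j ≤ c ∧ q = contract [a, b - j, c - j]) ∨
    (∃ j, 0 < j ∧ j ≤ a ∧ j ≤ b ∧ q = contract [a - j, b - j, c]) := by
  unfold Move at h
  have e : contract [a, b, c] = [a, b, c] := by
    simp [contract, ha.ne', hb.ne', hc.ne']
  rw [e] at h
  rcases h with ⟨x, t, k, hp, hk, hkx, rfl⟩ | ⟨x, t, k, hp, hk, hkx, rfl⟩ |
    ⟨α, x, y, β, k, hp, hk, hkx, hky, rfl⟩
  · simp only [List.cons.injEq] at hp
    obtain ⟨rfl, rfl⟩ := hp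
    exact Or.inr (Or.inl ⟨a - k, by omega, rfl⟩)
  · have hp' : [a, b] ++ [c] = t ++ [x] := hp
    obtain ⟨rfl, h2⟩ := List.append_inj' hp' rfl
    simp only [List.cons.injEq, and_true] at h2
    subst h2
    exact Or.inl ⟨c - k, by omega, rfl⟩
  · rcases α with _ | ⟨p, _ | ⟨p', r⟩⟩
    · simp only [List.nil_append, List.cons.injEq] at hp
      obtain ⟨rfl, rfl, rfl⟩ := hp
      exact Or.inr (Or.inr (Or.inr ⟨k, hk, hkx, hky, rfl⟩))
    · simp only [List.cons_append, List.nil_append, List.cons.injEq] at hp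
      obtain ⟨rfl, rfl, rfl, rfl⟩ := hp
      exact Or.inr (Or.inr (Or.inl ⟨k, hk, hkx, hky, rfl⟩))
    · have := congrArg List.length hp
      simp at this
      omega

theorem move2 (b c : ℕ) (hb : 0 < b) (hc : 0 < c) (q : List ℕ)
    (h : Move [b, c] q) :
    (∃ c', c' < c ∧ q = contract [b, c']) ∨ (∃ b', b' < b ∧ q = contract [b', c]) ∨
    (∃ j, 0 < j ∧ j ≤ b ∧ j ≤ c ∧ q = contract [b - j, c - j]) := by
  unfold Move at h
  have e : contract [b, c] = [b, c] := by
    simp [contract, hb.ne', hc.ne']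
  rw [e] at h
  rcases h with ⟨x, t, k, hp, hk, hkx, rfl⟩ | ⟨x, t, k, hp, hk, hkx, rfl⟩ |
    ⟨α, x, y, β, k, hp, hk, hkx, hky, rfl⟩
  · simp only [List.cons.injEq] at hp
    obtain ⟨rfl, rfl⟩ := hp
    exact Or.inr (Or.inl ⟨b - k, by omega, rfl⟩)
  · have hp' : [b] ++ [c] = t ++ [x] := hp
    obtain ⟨rfl, h2⟩ := List.append_inj' hp' rfl
    simp only [List.cons.injEq, and_true] at h2
    subst h2
    exact Or.inl ⟨c - k, by omega, rfl⟩
  · rcases α with _ | ⟨p, r⟩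
    · simp only [List.nil_append, List.cons.injEq] at hp
      obtain ⟨rfl, rfl, rfl⟩ := hp
      exact Or.inr (Or.inr ⟨k, hk, hkx, hky, rfl⟩)
    · have := congrArg List.length hp
      simp at this
      omega

theorem contract2 (b c : ℕ) : contract (contract [b, c]) = contract [b, c] := by
  by_cases hb : b = 0 <;> by_cases hc : c = 0 <;> simp [contract, hb, hc]

theorem ppos_contract2 (b c : ℕ) : PPos (contract [b, c]) ↔ PPos [b, c] :=
  ppos_congr (contract2 b c)

theorem move2_c (b c c' : ℕ) (hb : 0 < b) (h : c' < c) : Move [b, c] (contract [b, c']) := by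
  have e : c - (c - c') = c' := by omega
  refine Or.inr (Or.inl ⟨c, [b], c - c', ?_, by omega, by omega, ?_⟩) <;>
    simp [contract, hb.ne', e]
  omega

theorem move2_b (b c b' : ℕ) (hc : 0 < c) (h : b' < b) : Move [b, c] (contract [b', c]) := by
  have e : b - (b - b') = b' := by omega
  refine Or.inl ⟨b, [c], b - b', ?_, by omega, by omega, ?_⟩
  · simp [contract, hc.ne']; omega
  · rw [e]

theorem move2_d (b c j : ℕ) (h : 0 < j) (hb : j ≤ b) (hc : j ≤ c) :
    Move [b, c] (contract [b - j, c - j]) := by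
  refine Or.inr (Or.inr ⟨[], b, c, [], j, ?_, h, hb, hc, rfl⟩)
  have h1 : b ≠ 0 := by omega
  have h2 : c ≠ 0 := by omega
  simp [contract, h1, h2]

theorem not_of_move2 {b c b' c' : ℕ} (h : PPos [b, c])
    (hm : Move [b, c] (contract [b', c'])) : ¬ PPos [b', c'] := by
  rw [← ppos_contract2]
  exact (ppos_iff _).1 h _ hm

theorem sym2 : ∀ n b c : ℕ, b + c < n → PPos [b, c] → PPos [c, b] := by
  intro n
  induction n with
  | zero => intros; omega
  | succ n ih =>
    intro b c hn h
    rcases Nat.eq_zero_or_pos b with rfl | hb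
    · refine (ppos_congr ?_).1 h
      by_cases hc : c = 0 <;> simp [contract, hc]
    rcases Nat.eq_zero_or_pos c with rfl | hc
    · refine (ppos_congr ?_).1 h
      simp [contract]
    rw [ppos_iff]
    intro q hq
    rcases move2 c b hc hb q hq with ⟨x, hx, rfl⟩ | ⟨x, hx, rfl⟩ | ⟨j, h1, h2, h3, rfl⟩ <;>
      rw [ppos_contract2] <;> intro hp
    · exact not_of_move2 h (move2_b b c x hc hx) (ih _ _ (by omega) hp)
    · exact not_of_move2 h (move2_c b c x hb hx) (ih _ _ (by omega) hp)
    · exact not_of_move2 h (move2_d b c j h1 h3 h2) (ih _ _ (by omega) hp)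

theorem move_a (a b c a' : ℕ) (hb : 0 < b) (hc : 0 < c) (h : a' < a) :
    Move [a, b, c] (contract [a', b, c]) := by
  have e : a - (a - a') = a' := by omega
  refine Or.inl ⟨a, [b, c], a - a', ?_, by omega, by omega, ?_⟩
  · have : a ≠ 0 := by omega
    simp [contract, hb.ne', hc.ne', this]
  · rw [e]

theorem move_d' (a b c j : ℕ) (hc : 0 < c) (h : 0 < j) (h1 : j ≤ a) (h2 : j ≤ b) :
    Move [a, b, c] (contract [a - j, b - j, c]) := by
  refine Or.inr (Or.inr ⟨[], a, b, [c], j, ?_, h, h1, h2, rfl⟩)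
  have ha : a ≠ 0 := by omega
  have hb : b ≠ 0 := by omega
  simp [contract, ha, hb, hc.ne']

theorem move_dsub (a b c j : ℕ) (h : 0 < j) (h1 : j ≤ b) (h2 : j ≤ c) :
    Move [a, b, c] (contract [a, b - j, c - j]) := by
  have := move_d a (b - j) (c - j) j h
  rwa [Nat.sub_add_cancel h1, Nat.sub_add_cancel h2] at this

theorem sym3 : ∀ n a b c : ℕ, a + b + c < n → PPos [a, b, c] → PPos [c, b, a] := by
  intro n
  induction n with
  | zero => intros; omega
  | succ n ih =>
    intro a b c hn h
    rcases Nat.eq_zero_or_pos b with rfl | hb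
    · refine (ppos_congr ?_).1 h
      by_cases ha : a = 0 <;> by_cases hc : c = 0 <;> simp [contract, ha, hc]
      omega
    rcases Nat.eq_zero_or_pos a with rfl | ha
    · have h1 : PPos [b, c] := (ppos_congr (by simp [contract])).1 h
      refine (ppos_congr ?_).1 (sym2 _ b c (Nat.lt_succ_self _) h1)
      by_cases hc : c = 0 <;> simp [contract, hc, hb.ne']
    rcases Nat.eq_zero_or_pos c with rfl | hc
    · have h1 : PPos [a, b] := (ppos_congr (by simp [contract, ha.ne', hb.ne'])).1 h
      refine (ppos_congr ?_).1 (sym2 _ a b (Nat.lt_succ_self _) h1)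
      simp [contract]
    rw [ppos_iff]
    intro q hq
    rcases move3 c b a hc hb ha q hq with ⟨x, hx, rfl⟩ | ⟨x, hx, rfl⟩ |
      ⟨j, h1, h2, h3, rfl⟩ | ⟨j, h1, h2, h3, rfl⟩ <;>
      rw [ppos_contract3] <;> intro hp
    · exact not_of_move h (move_a a b c x hb hc hx) (ih _ _ _ (by omega) hp)
    · exact not_of_move h (move_c a b c x hx) (ih _ _ _ (by omega) hp)
    · exact not_of_move h (move_d' a b c j hc h1 h3 h2) (ih _ _ _ (by omega) hp)
    · exact not_of_move h (move_dsub a b c j h1 h3 h2) (ih _ _ _ (by omega) hp)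

theorem ppos_hasWin : HasWin (fun a b c => PPos [a, b, c]) := by
  intro a b c ha hb hc h
  simp only at h ⊢
  rw [ppos_iff] at h
  push Not at h
  obtain ⟨q, hq, hp⟩ := h
  rcases move3 a b c ha hb hc q hq with ⟨x, hx, rfl⟩ | ⟨x, hx, rfl⟩ |
      ⟨j, h1, h2, h3, rfl⟩ | ⟨j, h1, h2, h3, rfl⟩ <;>
      rw [ppos_contract3] at hp
  · exact Or.inl ⟨x, hx, hp⟩
  · exact Or.inr (Or.inl ⟨x, hx, hp⟩)
  · exact Or.inr (Or.inr (Or.inl ⟨j, h1, h2, h3, hp⟩))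
  · exact Or.inr (Or.inr (Or.inr ⟨j, h1, h2, h3, hp⟩))

theorem ppos_uniq (a b c c' : ℕ) (h : PPos [a, b, c]) (h' : PPos [a, b, c']) : c = c' := by
  rcases lt_trichotomy c c' with hl | hl | hl
  · exact absurd h (not_of_move h' (move_c a b c' c hl))
  · exact hl
  · exact absurd h' (not_of_move h (move_c a b c c' hl))

theorem ppos_diag (a b c b' c' : ℕ) (h : PPos [a, b, c]) (h' : PPos [a, b', c'])
    (he : c + b' = c' + b) : b = b' := by
  rcases lt_trichotomy b b' with hl | hl | hl
  · obtain ⟨j, rfl⟩ := Nat.exists_eq_add_of_lt hl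
    obtain rfl : c' = c + (j + 1) := by omega
    exact absurd h (not_of_move h' (move_d a b c (j + 1) (by omega)))
  · exact hl
  · obtain ⟨j, rfl⟩ := Nat.exists_eq_add_of_lt hl
    obtain rfl : c = c' + (j + 1) := by omega
    exact absurd h' (not_of_move h (move_d a b' c' (j + 1) (by omega)))

theorem ppos_zero (a c : ℕ) (h : PPos [a, 0, c]) : a = 0 := by
  by_contra ha
  have h1 : PPos [0, 0, a + c] := by
    refine (ppos_congr ?_).1 h
    simp [contract, ha]
  refine not_of_move h1 (move_c 0 0 (a + c) 0 (by omega)) ?_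
  rw [ppos_iff]
  intro q hq
  have := hq.sum_lt
  simp at this

end TwystOff

theorem P_c_lt_a_add_b (a b c : ℕ) (h : TwystOff.PPos [a, b, c]) (ha : 0 < a) :
    c < a + b := by
  exact TwystOff.abstract_main (P := fun a b c => TwystOff.PPos [a, b, c])
    (fun a b c => TwystOff.sym3 _ a b c (Nat.lt_succ_self _))
    TwystOff.ppos_uniq TwystOff.ppos_diag TwystOff.ppos_zero TwystOff.ppos_hasWin
    _ a b c (Nat.lt_succ_self _) ha h
end

section
/- For three-stack positions (a,b,c) other than those of the form (a,0,a), Twyst-off and frozen Twyst-off have exactly the same P positions: (a,b,c) is P for Twyst-off if and only if it is P for frozen Twyst-off, whenever (a,b,c) ≠ (a,0,a). -/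
namespace FrozenTwystOff

/-- Frozen contraction: empty stacks are removed only from the two ends;
interior zero stacks are NOT contracted. -/
def fcontract (l : List ℕ) : List ℕ :=
  ((l.dropWhile (fun x => x = 0)).reverse.dropWhile (fun x => x = 0)).reverse

theorem dropZeros_sum (l : List ℕ) : (l.dropWhile (fun x => x = 0)).sum = l.sum := by
  induction l with
  | nil => simp
  | cons a t ih => by_cases h : a = 0 <;> simp [List.dropWhile_cons, h, ih]

theorem fcontract_sum (l : List ℕ) : (fcontract l).sum = l.sum := by
  rw [fcontract, List.sum_reverse, dropZeros_sum, List.sum_reverse, dropZeros_sum]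

/-- A move: remove `k > 0` tiles from an end stack, or `k` tiles from each of two
consecutive stacks; empty end stacks are then deleted (no interior contraction). -/
def premove (p q : List ℕ) : Prop :=
  (∃ a t k, p = a :: t ∧ 0 < k ∧ k ≤ a ∧ q = fcontract ((a - k) :: t)) ∨
  (∃ a t k, p = t ++ [a] ∧ 0 < k ∧ k ≤ a ∧ q = fcontract (t ++ [a - k])) ∨
  (∃ α a b β k, p = α ++ a :: b :: β ∧ 0 < k ∧ k ≤ a ∧ k ≤ b ∧
      q = fcontract (α ++ (a - k) :: (b - k) :: β))

/-- Moves of frozen Twyst-off (positions are considered up to removal of end zeros). -/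
def Move (p q : List ℕ) : Prop := premove (fcontract p) q

theorem Move.sum_lt {p q : List ℕ} (h : Move p q) : q.sum < p.sum := by
  rw [← fcontract_sum p]
  rcases h with ⟨a, t, k, hp, hk, hka, hq⟩ | ⟨a, t, k, hp, hk, hka, hq⟩ |
    ⟨α, a, b, β, k, hp, hk, hka, hkb, hq⟩ <;>
    subst hq <;> rw [fcontract_sum, hp] <;> simp [List.sum_append] <;> omega

/-- P positions: every option is an N position (i.e. no option is itself P). -/
def PPos (p : List ℕ) : Prop := ∀ q, Move p q → ¬ PPos q
termination_by p.sum
decreasing_by exact Move.sum_lt (by assumption)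

/-- N positions: some option is a P position. -/
def NPos (p : List ℕ) : Prop := ∃ q, Move p q ∧ PPos q

end FrozenTwystOff


section Abstract

/-- Options of a three-stack position, in the encoding in which end stacks may be empty. -/
inductive TriOpt : ℕ → ℕ → ℕ → ℕ → ℕ → ℕ → Prop
  | left (x y z x' : ℕ) : x' < x → TriOpt x y z x' y z
  | right (x y z z' : ℕ) : z' < z → TriOpt x y z x y z'
  | pairL (x y z k : ℕ) : 0 < k → TriOpt (x + k) (y + k) z x y z
  | pairR (x y z k : ℕ) : 0 < k → TriOpt x (y + k) (z + k) x y z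
  | mid (x y z y' : ℕ) : x = 0 ∨ z = 0 → y' < y → TriOpt x y z x y' z

theorem TriOpt.lt {x y z x' y' z' : ℕ} (h : TriOpt x y z x' y' z') :
    x' + y' + z' < x + y + z := by
  cases h <;> omega

theorem TriOpt.symm {x y z x' y' z' : ℕ} (h : TriOpt x y z x' y' z') :
    TriOpt z y x z' y' x' := by
  cases h with
  | left _ _ _ _ h => exact .right _ _ _ _ h
  | right _ _ _ _ h => exact .left _ _ _ _ h
  | pairL _ _ _ _ h => exact .pairR _ _ _ _ h
  | pairR _ _ _ _ h => exact .pairL _ _ _ _ h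
  | mid _ _ _ _ h h' => exact .mid _ _ _ _ h.symm h'

variable {T : ℕ → ℕ → ℕ → Prop}

/-- The recursion satisfied by the P positions of Twyst-off. -/
structure TwystRec (T : ℕ → ℕ → ℕ → Prop) : Prop where
  zero : ∀ x z, T x 0 z ↔ x + z = 0
  pos : ∀ x y z, 0 < y → (T x y z ↔ ∀ x' y' z', TriOpt x y z x' y' z' → ¬ T x' y' z')

theorem TwystRec.symm (hT : TwystRec T) : ∀ n x y z, x + y + z = n → (T x y z → T z y x) := by
  intro n
  induction n using Nat.strong_induction_on with
  | _ n ih =>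
    intro x y z hn h
    rcases Nat.eq_zero_or_pos y with rfl | hy
    · rw [hT.zero] at h ⊢; omega
    · rw [hT.pos _ _ _ hy] at h ⊢
      intro x' y' z' ho hc
      have := ho.lt
      exact h _ _ _ ho.symm (ih _ (by omega) x' y' z' rfl hc)

theorem TwystRec.sy (hT : TwystRec T) {x y z : ℕ} (h : T x y z) : T z y x :=
  hT.symm _ _ _ _ rfl h

theorem TwystRec.uniqueLeft (hT : TwystRec T) {x x' y z : ℕ} (hy : 0 < y) (h : T x y z)
    (h' : T x' y z) : x = x' := by
  rcases lt_trichotomy x x' with hl | hl | hl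
  · exact absurd h ((hT.pos _ _ _ hy).1 h' _ _ _ (.left _ _ _ _ hl))
  · exact hl
  · exact absurd h' ((hT.pos _ _ _ hy).1 h _ _ _ (.left _ _ _ _ hl))

theorem TwystRec.diag (hT : TwystRec T) {x y z k : ℕ} (hk : 0 < k) (h : T (x + k) (y + k) z) :
    ¬ T x y z :=
  (hT.pos _ _ _ (by omega)).1 h _ _ _ (.pairL _ _ _ _ hk)

/-- If `(x,y,z)` with all stacks nonempty is not P, it has one of four kinds of P options. -/
theorem TwystRec.greedy (hT : TwystRec T) {x y z : ℕ} (hx : 0 < x) (hy : 0 < y) (hz : 0 < z)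
    (h : ¬ T x y z) :
    (∃ x' < x, T x' y z) ∨ (∃ z' < z, T x y z') ∨
    (∃ x' y' k, 0 < k ∧ 0 < y' ∧ x = x' + k ∧ y = y' + k ∧ T x' y' z) ∨
    (∃ y' z' k, 0 < k ∧ 0 < y' ∧ z = z' + k ∧ y = y' + k ∧ T x y' z') := by
  rw [hT.pos _ _ _ hy] at h
  push Not at h
  obtain ⟨x', y', z', ho, h⟩ := h
  cases ho with
  | left _ _ _ _ h1 => exact Or.inl ⟨_, h1, h⟩
  | right _ _ _ _ h1 => exact Or.inr (Or.inl ⟨_, h1, h⟩)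
  | pairL _ _ _ k h1 =>
    refine Or.inr (Or.inr (Or.inl ⟨_, _, k, h1, ?_, rfl, rfl, h⟩))
    rcases Nat.eq_zero_or_pos y' with rfl | h2
    · rw [hT.zero] at h; omega
    · exact h2
  | pairR _ _ _ k h1 =>
    refine Or.inr (Or.inr (Or.inr ⟨_, _, k, h1, ?_, rfl, rfl, h⟩))
    rcases Nat.eq_zero_or_pos y' with rfl | h2
    · rw [hT.zero] at h; omega
    · exact h2
  | mid _ _ _ _ h1 h2 => omega

/-- `Used T b c x`: in the plane with third coordinate `c`, the diagonal through `(x,b)` contains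
a P position in a lower row. -/
def Used (T : ℕ → ℕ → ℕ → Prop) (b c x : ℕ) : Prop :=
  ∃ x' y' k, 0 < k ∧ 0 < y' ∧ x = x' + k ∧ b = y' + k ∧ T x' y' c

theorem used_succ {b c x : ℕ} :
    Used T (b + 1) c (x + 1) ↔ (0 < b ∧ T x b c) ∨ Used T b c x := by
  constructor
  · rintro ⟨x', y', k, hk, hy, h1, h2, h⟩
    rcases Nat.lt_or_ge 1 k with h3 | h3
    · exact Or.inr ⟨x', y', k - 1, by omega, hy, by omega, by omega, h⟩
    · obtain rfl : x' = x := by omega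
      obtain rfl : y' = b := by omega
      exact Or.inl ⟨hy, h⟩
  · rintro (⟨hb, h⟩ | ⟨x', y', k, hk, hy, h1, h2, h⟩)
    · exact ⟨x, b, 1, by omega, hb, rfl, rfl, h⟩
    · exact ⟨x', y', k + 1, by omega, hy, by omega, by omega, h⟩

theorem TwystRec.not_used (hT : TwystRec T) {b c x : ℕ} (h : T x b c) : ¬ Used T b c x := by
  rintro ⟨x', y', k, hk, hy, rfl, rfl, h'⟩
  exact hT.diag hk h h'

/-- If `(c,b,c)` is not P, there is a smaller partner for `c`, or the diagonal is used. -/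
theorem TwystRec.loop (hT : TwystRec T) {b c : ℕ} (hb : 0 < b) (hc : 0 < c) (h : ¬ T c b c) :
    (∃ z < c, T z b c) ∨ Used T b c c := by
  rcases hT.greedy hc hb hc h with h | ⟨z, hz, h⟩ | ⟨x', y', k, h⟩ | ⟨y', z', k, h1, h2, h3, h4, h⟩
  · exact Or.inl h
  · exact Or.inl ⟨z, hz, hT.sy h⟩
  · exact Or.inr ⟨x', y', k, h⟩
  · exact Or.inr ⟨z', y', k, h1, h2, h3, h4, hT.sy h⟩

/-- Active intervals have distinct left end points. -/
theorem TwystRec.active (hT : TwystRec T) : ∀ b l r r', 0 < l → l ≤ r → r < r' →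
    Used T b r l → ¬ Used T b r' l := by
  intro b
  induction b with
  | zero => rintro l r r' - - - ⟨x', y', k, h1, h2, h3, h4, h⟩; omega
  | succ b ih =>
    intro l r r' hl hlr hr h h'
    obtain ⟨m, rfl⟩ : ∃ m, l = m + 1 := ⟨l - 1, by omega⟩
    rw [used_succ] at h h'
    -- the mixed case
    have mixed : ∀ r1 r2, m < r1 → m < r2 → 0 < b → T m b r1 → ¬ Used T b r2 m := by
      intro r1 r2 h1 h2 hb hP hU
      have hm : 0 < m := by
        obtain ⟨x', y', k, h3, h4, h5, -⟩ := hU; omega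
      have hN : ¬ T m b m := fun h3 => by
        have := hT.uniqueLeft hb h3 (hT.sy hP); omega
      rcases hT.loop hb hm hN with ⟨z, hz, h3⟩ | h3
      · have := hT.uniqueLeft hb h3 (hT.sy hP); omega
      · exact ih m m r2 hm le_rfl h2 h3 hU
    rcases h with ⟨hb, h⟩ | h <;> rcases h' with ⟨hb', h'⟩ | h'
    · have := hT.uniqueLeft hb (hT.sy h) (hT.sy h'); omega
    · exact mixed r r' (by omega) (by omega) hb h h'
    · exact mixed r' r (by omega) (by omega) hb' h' h
    · have hm : 0 < m := by
        obtain ⟨x', y', k, h3, h4, h5, -⟩ := h; omega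
      exact ih m r r' hm (by omega) hr h h'

/-- The bound at level `b`. -/
def Bound (T : ℕ → ℕ → ℕ → Prop) (b : ℕ) : Prop := ∀ x c, 0 < c → T x b c → x < b + c

/-- The open upward slots at level `b`. -/
def SlotDisj (T : ℕ → ℕ → ℕ → Prop) (b : ℕ) : Prop :=
  ∀ c' c x, c' < c → c < x → x < b + c → (c' = 0 ∨ x < b + c') →
    Used T b c x ∨ Used T b c' x

theorem TwystRec.slot_succ (hT : TwystRec T) {b : ℕ} (hb : 0 < b) (hB : Bound T b)
    (hS : SlotDisj T b) : SlotDisj T (b + 1) := by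
  intro c' c x h1 h2 h3 h4
  obtain ⟨x, rfl⟩ : ∃ m, x = m + 1 := ⟨x - 1, by omega⟩
  rw [used_succ, used_succ]
  rcases Nat.lt_or_ge c x with h5 | h5
  · rcases hS c' c x h1 h5 (by omega) (by omega) with h | h
    · exact Or.inl (Or.inr h)
    · exact Or.inr (Or.inr h)
  · obtain rfl : x = c := by omega
    by_contra hcon
    push Not at hcon
    obtain ⟨⟨hN, hU⟩, hN', hU'⟩ := hcon
    rcases hT.loop hb (by omega) (hN hb) with ⟨z, hz, h⟩ | h
    · have hs := hT.sy h
      have hzU := hT.not_used hs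
      have hzb : z = 0 ∨ x < b + z := by
        rcases Nat.eq_zero_or_pos z with h0 | h0
        · exact Or.inl h0
        · exact Or.inr (hB _ _ h0 hs)
      rcases lt_trichotomy z c' with h6 | rfl | h6
      · rcases hS z c' x h6 h1 (by omega) hzb with h7 | h7
        · exact hU' h7
        · exact hzU h7
      · exact hN' hb hs
      · rcases hS c' z x h6 hz (by omega) (by omega) with h7 | h7
        · exact hzU h7
        · exact hU' h7
    · exact hU h

/-- Pigeonhole: some up slot is open. -/
theorem TwystRec.exists_slot (hT : TwystRec T) {b : ℕ} (hb : 0 < b) (c : ℕ) :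
    ∃ x, c ≤ x ∧ x < b + c ∧ ¬ Used T b c x := by
  by_contra hcon
  push Not at hcon
  have hex : ∀ i : Fin b, ∃ y : Fin (b - 1), ∃ x' k, 0 < k ∧ c + i.1 = x' + k ∧
      b = (y.1 + 1) + k ∧ T x' (y.1 + 1) c := by
    intro i
    obtain ⟨x', y', k, h1, h2, h3, h4, h⟩ := hcon (c + i.1) (by omega) (by omega)
    refine ⟨⟨y' - 1, by omega⟩, x', k, h1, h3, ?_, ?_⟩
    · simp only; omega
    · have : y' - 1 + 1 = y' := by omega
      simpa only [this] using h
  choose g hg using hex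
  obtain ⟨i, j, hij, he⟩ := Fintype.exists_ne_map_eq_of_card_lt g (by simp; omega)
  obtain ⟨x1, k1, h1, h2, h3, h4⟩ := hg i
  obtain ⟨x2, k2, h5, h6, h7, h8⟩ := hg j
  rw [he] at h3 h4
  have := hT.uniqueLeft (by omega) h4 h8
  exact hij (Fin.ext (by omega))

theorem TwystRec.bound_of_slot (hT : TwystRec T) {b : ℕ} (hb : 0 < b) (hS : SlotDisj T b) :
    Bound T b := by
  suffices H : ∀ c x, 0 < c → T x b c → x < b + c from fun x c => H c x
  intro c
  induction c using Nat.strong_induction_on with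
  | _ c ih =>
    intro X hc hX
    by_contra hlt
    have hno : ∀ x, x < b + c → ¬ T x b c := fun x hx h => by
      have := hT.uniqueLeft hb h hX; omega
    have hloop : Used T b c c := by
      rcases hT.loop hb hc (hno c (by omega)) with ⟨z, hz, h⟩ | h
      · exact absurd h (hno z (by omega))
      · exact h
    obtain ⟨x, hx1, hx2, hxU⟩ := hT.exists_slot hb c
    have hxc : c < x := by
      rcases Nat.lt_or_ge c x with h | h
      · exact h
      · obtain rfl : x = c := by omega
        exact absurd hloop hxU
    rcases hT.greedy (by omega) hb hc (hno x hx2) with ⟨x', h1, h⟩ | ⟨z', h1, h⟩ | h |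
      ⟨y', z', k, h1, h2, h3, h4, h⟩
    · exact hno x' (by omega) h
    · have hzb : z' = 0 ∨ x < b + z' := by
        rcases Nat.eq_zero_or_pos z' with h0 | h0
        · exact Or.inl h0
        · exact Or.inr (ih z' h1 x h0 h)
      rcases hS z' c x h1 hxc hx2 hzb with h2 | h2
      · exact hxU h2
      · exact hT.not_used h h2
    · exact hxU h
    · exact hT.active b c c x hc le_rfl hxc hloop ⟨z', y', k, h1, h2, h3, h4, hT.sy h⟩

theorem TwystRec.slot_bound (hT : TwystRec T) : ∀ b, SlotDisj T (b + 1) ∧ Bound T (b + 1) := by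
  intro b
  induction b with
  | zero =>
    have : SlotDisj T 1 := by intro c' c x h1 h2 h3; omega
    exact ⟨this, hT.bound_of_slot (by omega) this⟩
  | succ b ih =>
    have := hT.slot_succ (by omega) ih.2 ih.1
    exact ⟨this, hT.bound_of_slot (by omega) this⟩

/-- The triangle inequality for P positions of Twyst-off. -/
theorem TwystRec.bound (hT : TwystRec T) {x y z : ℕ} (hy : 0 < y) (hz : 0 < z) (h : T x y z) :
    x < y + z := by
  obtain ⟨b, rfl⟩ : ∃ b, y = b + 1 := ⟨y - 1, by omega⟩
  exact (hT.slot_bound b).2 x z hz h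

variable {F : ℕ → ℕ → ℕ → Prop}

theorem frozen_zero (hF : ∀ x y z, F x y z ↔ ∀ x' y' z', TriOpt x y z x' y' z' → ¬ F x' y' z') :
    ∀ n x z, x + z = n → (F x 0 z ↔ x = z) := by
  intro n
  induction n using Nat.strong_induction_on with
  | _ n ih =>
    intro x z hn
    constructor
    · intro h
      by_contra hne
      rw [hF] at h
      rcases Nat.lt_or_gt_of_ne hne with h1 | h1
      · exact h _ _ _ (.right x 0 z x h1) ((ih (x + x) (by omega) x x rfl).2 rfl)
      · exact h _ _ _ (.left x 0 z z h1) ((ih (z + z) (by omega) z z rfl).2 rfl)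
    · rintro rfl
      rw [hF]
      intro x' y' z' ho
      generalize hy : (0 : ℕ) = y at ho
      cases ho with
      | left _ _ _ _ h => subst hy; rw [ih (x' + x) (by omega) _ _ rfl]; omega
      | right _ _ _ _ h => subst hy; rw [ih (x + z') (by omega) _ _ rfl]; omega
      | pairL => omega
      | pairR => omega
      | mid => omega

theorem same_abstract (hT : TwystRec T)
    (hF : ∀ x y z, F x y z ↔ ∀ x' y' z', TriOpt x y z x' y' z' → ¬ F x' y' z') :
    ∀ n a b c, a + b + c = n → ¬ (b = 0 ∧ c = a) → (T a b c ↔ F a b c) := by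
  intro n
  induction n using Nat.strong_induction_on with
  | _ n ih =>
    intro a b c hn hne
    rcases Nat.eq_zero_or_pos b with rfl | hb
    · rw [hT.zero, frozen_zero hF _ _ _ rfl]; omega
    · constructor
      · intro h
        rw [hF]
        intro x' y' z' ho hf
        have hlt := ho.lt
        by_cases hd : y' = 0 ∧ z' = x'
        · obtain ⟨rfl, rfl⟩ := hd
          rcases Nat.eq_zero_or_pos z' with rfl | hz
          · exact (hT.pos _ _ _ hb).1 h _ _ _ ho ((hT.zero _ _).2 rfl)
          · generalize hy : (0 : ℕ) = y at ho
            generalize hx : z' = x at ho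
            cases ho with
            | left => omega
            | right => omega
            | pairL => have := hT.bound hb (by omega) h; omega
            | pairR => have := hT.bound hb (by omega) (hT.sy h); omega
            | mid => omega
        · exact (hT.pos _ _ _ hb).1 h _ _ _ ho ((ih _ (by omega) x' y' z' rfl hd).2 hf)
      · intro h
        rw [hT.pos _ _ _ hb]
        intro x' y' z' ho ht
        have hlt := ho.lt
        refine (hF _ _ _).1 h _ _ _ ho ?_
        by_cases hd : y' = 0 ∧ z' = x'
        · obtain ⟨rfl, rfl⟩ := hd
          exact (frozen_zero hF _ _ _ rfl).2 rfl
        · exact (ih _ (by omega) x' y' z' rfl hd).1 ht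

end Abstract

/-- Raw moves relative to an arbitrary normalisation `f`. -/
def GMove (f : List ℕ → List ℕ) (p q : List ℕ) : Prop :=
  (∃ a t k, p = a :: t ∧ 0 < k ∧ k ≤ a ∧ q = f ((a - k) :: t)) ∨
  (∃ a t k, p = t ++ [a] ∧ 0 < k ∧ k ≤ a ∧ q = f (t ++ [a - k])) ∨
  (∃ α a b β k, p = α ++ a :: b :: β ∧ 0 < k ∧ k ≤ a ∧ k ≤ b ∧
      q = f (α ++ (a - k) :: (b - k) :: β))

theorem GMove_nil (f : List ℕ → List ℕ) (q : List ℕ) : ¬ GMove f [] q := by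
  simp [GMove]

theorem GMove_one (f : List ℕ → List ℕ) (x : ℕ) (q : List ℕ) :
    GMove f [x] q ↔ ∃ x', x' < x ∧ q = f [x'] := by
  constructor
  · rintro (⟨a, t, k, hp, h0, h1, rfl⟩ | ⟨a, t, k, hp, h0, h1, rfl⟩ |
      ⟨α, a, b, β, k, hp, h0, h1, h2, rfl⟩)
    · simp at hp
      obtain ⟨rfl, rfl⟩ := hp
      exact ⟨x - k, by omega, rfl⟩
    · rcases t with _ | ⟨u, t⟩ <;> simp at hp
      subst hp
      exact ⟨x - k, by omega, rfl⟩
    · rcases α with _ | ⟨u, α⟩ <;> simp at hp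
  · rintro ⟨x', h, rfl⟩
    exact Or.inl ⟨x, [], x - x', rfl, by omega, by omega, by
      rw [show x - (x - x') = x' by omega]⟩

theorem GMove_two (f : List ℕ → List ℕ) (x y : ℕ) (q : List ℕ) :
    GMove f [x, y] q ↔ (∃ x', x' < x ∧ q = f [x', y]) ∨ (∃ y', y' < y ∧ q = f [x, y']) ∨
      (∃ k, 0 < k ∧ k ≤ x ∧ k ≤ y ∧ q = f [x - k, y - k]) := by
  constructor
  · rintro (⟨a, t, k, hp, h0, h1, rfl⟩ | ⟨a, t, k, hp, h0, h1, rfl⟩ |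
      ⟨α, a, b, β, k, hp, h0, h1, h2, rfl⟩)
    · simp at hp
      obtain ⟨rfl, rfl⟩ := hp
      exact Or.inl ⟨x - k, by omega, rfl⟩
    · rcases t with _ | ⟨u, _ | ⟨v, t⟩⟩ <;> simp at hp
      obtain ⟨rfl, rfl⟩ := hp
      exact Or.inr (Or.inl ⟨y - k, by omega, rfl⟩)
    · rcases α with _ | ⟨u, _ | ⟨v, α⟩⟩ <;> simp at hp
      obtain ⟨rfl, rfl, rfl⟩ := hp
      exact Or.inr (Or.inr ⟨k, h0, h1, h2, rfl⟩)
  · rintro (⟨x', h, rfl⟩ | ⟨y', h, rfl⟩ | ⟨k, h0, h1, h2, rfl⟩)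
    · exact Or.inl ⟨x, [y], x - x', rfl, by omega, by omega, by
        rw [show x - (x - x') = x' by omega]⟩
    · exact Or.inr (Or.inl ⟨y, [x], y - y', rfl, by omega, by omega, by
        rw [show y - (y - y') = y' by omega]; rfl⟩)
    · exact Or.inr (Or.inr ⟨[], x, y, [], k, rfl, h0, h1, h2, rfl⟩)

theorem GMove_three (f : List ℕ → List ℕ) (x y z : ℕ) (q : List ℕ) :
    GMove f [x, y, z] q ↔ (∃ x', x' < x ∧ q = f [x', y, z]) ∨
      (∃ z', z' < z ∧ q = f [x, y, z']) ∨
      (∃ k, 0 < k ∧ k ≤ x ∧ k ≤ y ∧ q = f [x - k, y - k, z]) ∨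
      (∃ k, 0 < k ∧ k ≤ y ∧ k ≤ z ∧ q = f [x, y - k, z - k]) := by
  constructor
  · rintro (⟨a, t, k, hp, h0, h1, rfl⟩ | ⟨a, t, k, hp, h0, h1, rfl⟩ |
      ⟨α, a, b, β, k, hp, h0, h1, h2, rfl⟩)
    · simp at hp
      obtain ⟨rfl, rfl⟩ := hp
      exact Or.inl ⟨x - k, by omega, rfl⟩
    · rcases t with _ | ⟨u, _ | ⟨v, _ | ⟨w, t⟩⟩⟩ <;> simp at hp
      obtain ⟨rfl, rfl, rfl⟩ := hp
      exact Or.inr (Or.inl ⟨z - k, by omega, rfl⟩)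
    · rcases α with _ | ⟨u, _ | ⟨v, _ | ⟨w, α⟩⟩⟩ <;> simp at hp
      · obtain ⟨rfl, rfl, rfl⟩ := hp
        exact Or.inr (Or.inr (Or.inl ⟨k, h0, h1, h2, rfl⟩))
      · obtain ⟨rfl, rfl, rfl, rfl⟩ := hp
        exact Or.inr (Or.inr (Or.inr ⟨k, h0, h1, h2, rfl⟩))
  · rintro (⟨x', h, rfl⟩ | ⟨z', h, rfl⟩ | ⟨k, h0, h1, h2, rfl⟩ | ⟨k, h0, h1, h2, rfl⟩)
    · exact Or.inl ⟨x, [y, z], x - x', rfl, by omega, by omega, by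
        rw [show x - (x - x') = x' by omega]⟩
    · exact Or.inr (Or.inl ⟨z, [x, y], z - z', rfl, by omega, by omega, by
        rw [show z - (z - z') = z' by omega]; rfl⟩)
    · exact Or.inr (Or.inr ⟨[], x, y, [z], k, rfl, h0, h1, h2, rfl⟩)
    · exact Or.inr (Or.inr ⟨[x], y, z, [], k, rfl, h0, h1, h2, rfl⟩)

/-- Basic behaviour of a normalisation on short lists. -/
structure StackNorm (f : List ℕ → List ℕ) : Prop where
  nil : f [] = []
  one : ∀ x, 0 < x → f [x] = [x]
  two : ∀ x y, 0 < x → 0 < y → f [x, y] = [x, y]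
  z1 : f [0] = []
  l2 : ∀ y, f [0, y] = f [y]
  r2 : ∀ y, f [y, 0] = f [y]
  l3 : ∀ y z, f [0, y, z] = f [y, z]
  r3 : ∀ x y, f [x, y, 0] = f [x, y]

theorem triOpt_iff (x y z : ℕ) (Q : ℕ → ℕ → ℕ → Prop) :
    (∃ x' y' z', TriOpt x y z x' y' z' ∧ Q x' y' z') ↔
      (∃ x', x' < x ∧ Q x' y z) ∨ (∃ z', z' < z ∧ Q x y z') ∨
      (∃ k, 0 < k ∧ k ≤ x ∧ k ≤ y ∧ Q (x - k) (y - k) z) ∨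
      (∃ k, 0 < k ∧ k ≤ y ∧ k ≤ z ∧ Q x (y - k) (z - k)) ∨
      (∃ y', (x = 0 ∨ z = 0) ∧ y' < y ∧ Q x y' z) := by
  constructor
  · rintro ⟨x', y', z', h, hQ⟩
    cases h with
    | left _ _ _ _ h => exact Or.inl ⟨_, h, hQ⟩
    | right _ _ _ _ h => exact Or.inr (Or.inl ⟨_, h, hQ⟩)
    | pairL _ _ _ k h =>
      exact Or.inr (Or.inr (Or.inl ⟨k, h, by omega, by omega, by simpa using hQ⟩))
    | pairR _ _ _ k h =>
      exact Or.inr (Or.inr (Or.inr (Or.inl ⟨k, h, by omega, by omega, by simpa using hQ⟩)))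
    | mid _ _ _ _ h h2 => exact Or.inr (Or.inr (Or.inr (Or.inr ⟨_, h, h2, hQ⟩)))
  · rintro (⟨x', h, hQ⟩ | ⟨z', h, hQ⟩ | ⟨k, h0, h1, h2, hQ⟩ | ⟨k, h0, h1, h2, hQ⟩ | ⟨y', h, h2, hQ⟩)
    · exact ⟨_, _, _, TriOpt.left _ _ _ _ h, hQ⟩
    · exact ⟨_, _, _, TriOpt.right _ _ _ _ h, hQ⟩
    · refine ⟨x - k, y - k, z, ?_, hQ⟩
      have := TriOpt.pairL (x - k) (y - k) z k h0
      rwa [Nat.sub_add_cancel h1, Nat.sub_add_cancel h2] at this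
    · refine ⟨x, y - k, z - k, ?_, hQ⟩
      have := TriOpt.pairR x (y - k) (z - k) k h0
      rwa [Nat.sub_add_cancel h1, Nat.sub_add_cancel h2] at this
    · exact ⟨_, _, _, TriOpt.mid _ _ _ _ h h2, hQ⟩

theorem GMove_char {f : List ℕ → List ℕ} (hf : StackNorm f) (x y z : ℕ)
    (h3 : 0 < x → 0 < z → f [x, y, z] = [x, y, z]) (q : List ℕ) :
    GMove f (f [x, y, z]) q ↔ ∃ x' y' z', TriOpt x y z x' y' z' ∧ q = f [x', y', z'] := by
  rw [triOpt_iff x y z (fun x' y' z' => q = f [x', y', z'])]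
  rcases Nat.eq_zero_or_pos x with hx | hx
  · subst hx
    rw [hf.l3]
    rcases Nat.eq_zero_or_pos y with hy | hy
    · subst hy
      rw [hf.l2]
      rcases Nat.eq_zero_or_pos z with hz | hz
      · subst hz
        rw [hf.z1]
        simp [GMove_nil]
      · rw [hf.one z hz, GMove_one]
        simp only [hf.l3, hf.l2]
        constructor
        · intro h
          exact Or.inr (Or.inl h)
        · rintro (⟨_, h, _⟩ | h | ⟨k, h0, h1, _⟩ | ⟨k, h0, h1, _⟩ | ⟨y', _, h, _⟩)
          · omega
          · exact h
          all_goals omega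
    · rcases Nat.eq_zero_or_pos z with hz | hz
      · subst hz
        rw [hf.r2, hf.one y hy, GMove_one]
        simp only [hf.l3, hf.r2]
        constructor
        · rintro ⟨y', h, hq⟩
          exact Or.inr (Or.inr (Or.inr (Or.inr ⟨y', Or.inl (by trivial), h, hq⟩)))
        · rintro (⟨_, h, _⟩ | ⟨_, h, _⟩ | ⟨k, h0, h1, _⟩ | ⟨k, h0, _, h1, _⟩ | ⟨y', _, h, hq⟩)
          any_goals omega
          exact ⟨y', h, hq⟩
      · rw [hf.two y z hy hz, GMove_two]
        simp only [hf.l3]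
        constructor
        · rintro (⟨y', h, hq⟩ | h | h)
          · exact Or.inr (Or.inr (Or.inr (Or.inr ⟨y', Or.inl (by trivial), h, hq⟩)))
          · exact Or.inr (Or.inl h)
          · exact Or.inr (Or.inr (Or.inr (Or.inl h)))
        · rintro (⟨_, h, _⟩ | h | ⟨k, h0, h1, _⟩ | h | ⟨y', _, h, hq⟩)
          · omega
          · exact Or.inr (Or.inl h)
          · omega
          · exact Or.inr (Or.inr h)
          · exact Or.inl ⟨y', h, hq⟩
  · rcases Nat.eq_zero_or_pos z with hz | hz
    · subst hz
      rw [hf.r3]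
      rcases Nat.eq_zero_or_pos y with hy | hy
      · subst hy
        rw [hf.r2, hf.one x hx, GMove_one]
        simp only [hf.r3, hf.r2]
        constructor
        · intro h
          exact Or.inl h
        · rintro (h | ⟨_, h, _⟩ | ⟨k, h0, _, h1, _⟩ | ⟨k, h0, h1, _⟩ | ⟨y', _, h, _⟩)
          · exact h
          all_goals omega
      · rw [hf.two x y hx hy, GMove_two]
        simp only [hf.r3]
        constructor
        · rintro (h | ⟨y', h, hq⟩ | h)
          · exact Or.inl h
          · exact Or.inr (Or.inr (Or.inr (Or.inr ⟨y', Or.inr (by trivial), h, hq⟩)))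
          · exact Or.inr (Or.inr (Or.inl h))
        · rintro (h | ⟨_, h, _⟩ | h | ⟨k, h0, _, h1, _⟩ | ⟨y', _, h, hq⟩)
          · exact Or.inl h
          · omega
          · exact Or.inr (Or.inr h)
          · omega
          · exact Or.inr (Or.inl ⟨y', h, hq⟩)
    · rw [h3 hx hz, GMove_three]
      constructor
      · rintro (h | h | h | h)
        · exact Or.inl h
        · exact Or.inr (Or.inl h)
        · exact Or.inr (Or.inr (Or.inl h))
        · exact Or.inr (Or.inr (Or.inr (Or.inl h)))
      · rintro (h | h | h | h | ⟨_, h, _⟩)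
        · exact Or.inl h
        · exact Or.inr (Or.inl h)
        · exact Or.inr (Or.inr (Or.inl h))
        · exact Or.inr (Or.inr (Or.inr h))
        · omega

theorem norm_idem2 {f : List ℕ → List ℕ} (hf : StackNorm f) (x y : ℕ) :
    f (f [x, y]) = f [x, y] := by
  have h1 : ∀ w, f (f [w]) = f [w] := by
    intro w
    rcases Nat.eq_zero_or_pos w with rfl | h
    · rw [hf.z1, hf.nil]
    · rw [hf.one w h, hf.one w h]
  rcases Nat.eq_zero_or_pos x with rfl | hx
  · rw [hf.l2, h1]
  rcases Nat.eq_zero_or_pos y with rfl | hy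
  · rw [hf.r2, h1]
  rw [hf.two x y hx hy, hf.two x y hx hy]

theorem norm_idem3 {f : List ℕ → List ℕ} (hf : StackNorm f) (x y z : ℕ)
    (h3 : 0 < x → 0 < z → f (f [x, y, z]) = f [x, y, z]) :
    f (f [x, y, z]) = f [x, y, z] := by
  rcases Nat.eq_zero_or_pos x with rfl | hx
  · rw [hf.l3, norm_idem2 hf]
  rcases Nat.eq_zero_or_pos z with rfl | hz
  · rw [hf.r3, norm_idem2 hf]
  exact h3 hx hz

theorem norm_contract : StackNorm TwystOff.contract where
  nil := by simp [TwystOff.contract]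
  one := by intro x hx; simp [TwystOff.contract]; omega
  two := by intro x y hx hy; simp [TwystOff.contract, hx.ne', hy.ne']
  z1 := by simp [TwystOff.contract]
  l2 := by intro y; simp [TwystOff.contract]
  r2 := by intro y; simp [TwystOff.contract]
  l3 := by
    intro y z
    rw [TwystOff.contract.eq_def]
    simp
  r3 := by
    intro x y
    rcases Nat.eq_zero_or_pos x with rfl | hx <;> rcases Nat.eq_zero_or_pos y with rfl | hy <;>
      simp [TwystOff.contract, *, Nat.ne_of_gt]

theorem norm_fcontract : StackNorm FrozenTwystOff.fcontract where
  nil := by simp [FrozenTwystOff.fcontract]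
  one := by intro x hx; simp [FrozenTwystOff.fcontract, List.dropWhile_cons, hx.ne']
  two := by intro x y hx hy; simp [FrozenTwystOff.fcontract, List.dropWhile_cons, hx.ne', hy.ne']
  z1 := by simp [FrozenTwystOff.fcontract]
  l2 := by intro y; simp [FrozenTwystOff.fcontract, List.dropWhile_cons]
  r2 := by
    intro y
    rcases Nat.eq_zero_or_pos y with rfl | hy <;>
      simp [FrozenTwystOff.fcontract, List.dropWhile_cons, *, Nat.ne_of_gt]
  l3 := by intro y z; simp [FrozenTwystOff.fcontract, List.dropWhile_cons]
  r3 := by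
    intro x y
    rcases Nat.eq_zero_or_pos x with rfl | hx <;> rcases Nat.eq_zero_or_pos y with rfl | hy <;>
      simp [FrozenTwystOff.fcontract, List.dropWhile_cons, *, Nat.ne_of_gt]

theorem fcontract_three (x y z : ℕ) (hx : 0 < x) (hz : 0 < z) :
    FrozenTwystOff.fcontract [x, y, z] = [x, y, z] := by
  simp [FrozenTwystOff.fcontract, List.dropWhile_cons, hx.ne', hz.ne']

theorem contract_three (x y z : ℕ) (hx : 0 < x) (hy : 0 < y) (hz : 0 < z) :
    TwystOff.contract [x, y, z] = [x, y, z] := by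
  simp [TwystOff.contract, hx.ne', hy.ne', hz.ne']

theorem contract_mid_zero (x z : ℕ) :
    TwystOff.contract [x, 0, z] = TwystOff.contract [x + z] := by
  rcases Nat.eq_zero_or_pos x with rfl | hx
  · simp [norm_contract.l3, norm_contract.l2]
  · rw [TwystOff.contract.eq_def]
    simp [hx.ne']

theorem frozen_pos_iff (x y z : ℕ) :
    FrozenTwystOff.PPos (FrozenTwystOff.fcontract [x, y, z]) ↔ FrozenTwystOff.PPos [x, y, z] := by
  have : FrozenTwystOff.fcontract (FrozenTwystOff.fcontract [x, y, z])
      = FrozenTwystOff.fcontract [x, y, z] :=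
    norm_idem3 norm_fcontract x y z (fun hx hz => by
      rw [fcontract_three x y z hx hz, fcontract_three x y z hx hz])
  rw [FrozenTwystOff.PPos, FrozenTwystOff.PPos]
  simp only [FrozenTwystOff.Move, this]

theorem twyst_pos_congr {p q : List ℕ} (h : TwystOff.contract p = TwystOff.contract q) :
    TwystOff.PPos p ↔ TwystOff.PPos q := by
  rw [TwystOff.PPos, TwystOff.PPos]
  simp only [TwystOff.Move, h]

theorem twyst_pos_iff (x y z : ℕ) :
    TwystOff.PPos (TwystOff.contract [x, y, z]) ↔ TwystOff.PPos [x, y, z] := by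
  apply twyst_pos_congr
  apply norm_idem3 norm_contract x y z
  intro hx hz
  rcases Nat.eq_zero_or_pos y with rfl | hy
  · rw [contract_mid_zero, norm_contract.one _ (by omega), norm_contract.one _ (by omega)]
  · rw [contract_three x y z hx hy hz, contract_three x y z hx hy hz]

theorem frozen_rec (x y z : ℕ) : FrozenTwystOff.PPos [x, y, z] ↔
    ∀ x' y' z', TriOpt x y z x' y' z' → ¬ FrozenTwystOff.PPos [x', y', z'] := by
  have key := GMove_char norm_fcontract x y z (fun hx hz => fcontract_three x y z hx hz)
  rw [FrozenTwystOff.PPos]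
  constructor
  · intro h x' y' z' ho hp
    exact h _ ((key _).2 ⟨x', y', z', ho, rfl⟩) ((frozen_pos_iff x' y' z').2 hp)
  · intro h q hq hp
    obtain ⟨x', y', z', ho, rfl⟩ := (key q).1 hq
    exact h x' y' z' ho ((frozen_pos_iff x' y' z').1 hp)

theorem twyst_nil : TwystOff.PPos [] := by
  rw [TwystOff.PPos]
  intro q hq
  have hq' : GMove TwystOff.contract (TwystOff.contract []) q := hq
  rw [norm_contract.nil] at hq'
  exact absurd hq' (GMove_nil _ _)

theorem twyst_rec : TwystRec (fun x y z => TwystOff.PPos [x, y, z]) where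
  zero := by
    intro x z
    change TwystOff.PPos [x, 0, z] ↔ x + z = 0
    rw [twyst_pos_congr (contract_mid_zero x z)]
    rcases Nat.eq_zero_or_pos (x + z) with h | h
    · rw [h, twyst_pos_congr (p := [0]) (q := []) (by rw [norm_contract.z1, norm_contract.nil])]
      simp [twyst_nil]
    · refine ⟨fun hp => ?_, fun h0 => by omega⟩
      rw [TwystOff.PPos] at hp
      refine absurd twyst_nil (hp [] ?_)
      change GMove TwystOff.contract (TwystOff.contract [x + z]) []
      rw [norm_contract.one _ h, GMove_one]
      exact ⟨0, h, norm_contract.z1.symm⟩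
  pos := by
    intro x y z hy
    have key := GMove_char norm_contract x y z (fun hx hz => contract_three x y z hx hy hz)
    change TwystOff.PPos [x, y, z] ↔
      ∀ x' y' z', TriOpt x y z x' y' z' → ¬ TwystOff.PPos [x', y', z']
    rw [TwystOff.PPos]
    constructor
    · intro h x' y' z' ho hp
      exact h _ ((key _).2 ⟨x', y', z', ho, rfl⟩) ((twyst_pos_iff x' y' z').2 hp)
    · intro h q hq hp
      obtain ⟨x', y', z', ho, rfl⟩ := (key q).1 hq
      exact h x' y' z' ho ((twyst_pos_iff x' y' z').1 hp)

theorem same_P_positions (a b c : ℕ) (h : ¬(b = 0 ∧ c = a)) :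
    TwystOff.PPos [a, b, c] ↔ FrozenTwystOff.PPos [a, b, c] :=
  same_abstract (T := fun x y z => TwystOff.PPos [x, y, z])
    (F := fun x y z => FrozenTwystOff.PPos [x, y, z]) twyst_rec frozen_rec _ a b c rfl h
end

section
/- In Twyst-off with infinite stacks allowed, for positive integers a and b, the position (∞,a,b,∞) is a P position if and only if (a-1, b-1) is a P position of Wythoff's game. -/
namespace TwystOffInf

/-- Contraction for stacks of size in `ℕ∞`: merge the two neighbors of an interior zero
stack (merging with an infinite stack gives `⊤`); delete empty end stacks. -/
def contract : List ℕ∞ → List ℕ∞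
  | [] => []
  | a :: t =>
    if a = 0 then contract t
    else match t with
      | [] => [a]
      | [b] => if b = 0 then [a] else [a, b]
      | b :: c :: r => if b = 0 then contract ((a + c) :: r) else a :: contract (b :: c :: r)
termination_by l => l.length

/-- A raw move in Twyst-off with infinite stacks:
* reduce an end stack to any strictly smaller value (an `∞` end stack becomes any finite size);
* remove the same finite `k > 0` from two consecutive stacks, not both infinite
  (here `⊤ - k = ⊤`, so a pair `(∞, b)` becomes `(∞, b - k)`);
* reduce a consecutive pair `(∞, ∞)` to `(k, k)` for any finite `k`.
The result is then contracted. -/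
def premove (p q : List ℕ∞) : Prop :=
  (∃ a t a', p = a :: t ∧ a' < a ∧ q = contract (a' :: t)) ∨
  (∃ a t a', p = t ++ [a] ∧ a' < a ∧ q = contract (t ++ [a'])) ∨
  (∃ α a b β, ∃ k : ℕ, p = α ++ a :: b :: β ∧ 0 < k ∧ (k : ℕ∞) ≤ a ∧ (k : ℕ∞) ≤ b ∧
      (a ≠ ⊤ ∨ b ≠ ⊤) ∧ q = contract (α ++ (a - (k : ℕ∞)) :: (b - (k : ℕ∞)) :: β)) ∨
  (∃ α β, ∃ k : ℕ, p = α ++ (⊤ : ℕ∞) :: (⊤ : ℕ∞) :: β ∧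
      q = contract (α ++ (k : ℕ∞) :: (k : ℕ∞) :: β))

/-- Moves (positions are considered up to contraction). -/
def Move (p q : List ℕ∞) : Prop := premove (contract p) q

/-- P positions: every option is an N position, i.e. for every option there is a choice of
a further P option.  (The game terminates, so this inductive definition agrees with the
usual recursive definition of P and N positions.) -/
inductive PPos : List ℕ∞ → Prop where
  | mk (p : List ℕ∞) (opt : ∀ q, Move p q → List ℕ∞)
      (hmove : ∀ q (h : Move p q), Move q (opt q h))
      (hP : ∀ q (h : Move p q), PPos (opt q h)) : PPos p

/-- N positions: some option is a P position. -/
def NPos (p : List ℕ∞) : Prop := ∃ q, Move p q ∧ PPos q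

end TwystOffInf


namespace Wythoff

/-- A move in Wythoff's game: decrease one coordinate, or both by the same positive amount. -/
def Move (p q : ℕ × ℕ) : Prop :=
  (q.1 < p.1 ∧ q.2 = p.2) ∨ (q.1 = p.1 ∧ q.2 < p.2) ∨
  (∃ k, 0 < k ∧ k ≤ p.1 ∧ k ≤ p.2 ∧ q = (p.1 - k, p.2 - k))

theorem Move.sum_lt {p q : ℕ × ℕ} (h : Move p q) : q.1 + q.2 < p.1 + p.2 := by
  rcases h with ⟨h1, h2⟩ | ⟨h1, h2⟩ | ⟨k, hk, h1, h2, hq⟩ <;> subst_vars <;> simp_all <;> omega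

/-- P positions: every option is an N position (i.e. no option is itself P). -/
def PPos (p : ℕ × ℕ) : Prop := ∀ q, Move p q → ¬ PPos q
termination_by p.1 + p.2
decreasing_by exact Move.sum_lt (by assumption)

/-- N positions: some option is a P position. -/
def NPos (p : ℕ × ℕ) : Prop := ∃ q, Move p q ∧ PPos q

end Wythoff


namespace TwystOffInf

theorem contract_nil : contract [] = [] := by
  rw [contract]

theorem contract_zero (t : List ℕ∞) : contract (0 :: t) = contract t := by
  rw [contract.eq_def]; simp

theorem contract_one {a : ℕ∞} (ha : a ≠ 0) : contract [a] = [a] := by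
  rw [contract]; simp [ha]

theorem contract_two_zero {a : ℕ∞} (ha : a ≠ 0) : contract [a, 0] = [a] := by
  rw [contract]; simp [ha]

theorem contract_merge {a : ℕ∞} (ha : a ≠ 0) (c : ℕ∞) (r : List ℕ∞) :
    contract (a :: 0 :: c :: r) = contract ((a + c) :: r) := by
  rw [contract]; simp [ha]

theorem contract_cons {a b : ℕ∞} (ha : a ≠ 0) (hb : b ≠ 0) (t : List ℕ∞) :
    contract (a :: b :: t) = a :: contract (b :: t) := by
  cases t with
  | nil => rw [contract_one hb, contract]; simp [ha, hb]
  | cons c r => rw [contract]; simp [ha, hb]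

theorem contract_of_ne (l : List ℕ∞) (h : ∀ a ∈ l, a ≠ 0) : contract l = l := by
  induction l with
  | nil => exact contract_nil
  | cons a t ih =>
    cases t with
    | nil => exact contract_one (h a (by simp))
    | cons b t =>
      rw [contract_cons (h a (by simp)) (h b (by simp)), ih]
      intro x hx
      exact h x (List.mem_cons_of_mem _ hx)

theorem contract_props (n : ℕ) : ∀ l : List ℕ∞, l.length ≤ n →
    (∀ a ∈ contract l, a ≠ 0) ∧ (contract l).sum = l.sum := by
  induction n with
  | zero =>
    intro l hl
    have : l = [] := List.length_eq_zero_iff.mp (by omega)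
    subst this
    simp [contract_nil]
  | succ n ih =>
    intro l hl
    match l with
    | [] => simp [contract_nil]
    | a :: t =>
      by_cases ha : a = 0
      · subst ha
        rw [contract_zero]
        simpa using ih t (by simpa using hl)
      · match t with
        | [] => rw [contract_one ha]; simpa using ha
        | b :: t =>
          by_cases hb : b = 0
          · subst hb
            match t with
            | [] => rw [contract_two_zero ha]; simpa using ha
            | c :: r =>
              rw [contract_merge ha]
              have := ih ((a + c) :: r) (by simp at hl ⊢; omega)
              refine ⟨this.1, ?_⟩
              rw [this.2]
              simp [add_assoc]
          · rw [contract_cons ha hb]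
            have := ih (b :: t) (by simp at hl ⊢; omega)
            refine ⟨?_, ?_⟩
            · intro x hx
              rcases List.mem_cons.mp hx with rfl | hx
              · exact ha
              · exact this.1 x hx
            · rw [List.sum_cons, this.2, ← List.sum_cons]

theorem contract_ne (l : List ℕ∞) : ∀ a ∈ contract l, a ≠ 0 :=
  (contract_props l.length l le_rfl).1

theorem contract_sum (l : List ℕ∞) : (contract l).sum = l.sum :=
  (contract_props l.length l le_rfl).2

theorem contract_idem (l : List ℕ∞) : contract (contract l) = contract l :=
  contract_of_ne _ (contract_ne l)

theorem contract_right (n : ℕ) : ∀ l : List ℕ∞, l.length ≤ n → (∀ a ∈ l, a ≠ ⊤) →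
    ∃ (γ : List ℕ∞) (c : ℕ∞), c ≠ ⊤ ∧ ∀ x : ℕ∞, x ≠ 0 → contract (l ++ [x]) = γ ++ [c + x] := by
  induction n with
  | zero =>
    intro l hl _
    have : l = [] := List.length_eq_zero_iff.mp (by omega)
    subst this
    exact ⟨[], 0, by simp, fun x hx => by simp [contract_one hx]⟩
  | succ n ih =>
    intro l hl hf
    match l with
    | [] => exact ⟨[], 0, by simp, fun x hx => by simp [contract_one hx]⟩
    | a :: t =>
      by_cases ha : a = 0
      · subst ha
        obtain ⟨γ, c, hc, h⟩ := ih t (by simpa using hl) (fun x hx => hf x (by simp [hx]))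
        exact ⟨γ, c, hc, fun x hx => by rw [List.cons_append, contract_zero, h x hx]⟩
      · match t with
        | [] =>
          refine ⟨[a], 0, by simp, fun x hx => ?_⟩
          simp [contract_cons ha hx, contract_one hx]
        | b :: t =>
          by_cases hb : b = 0
          · subst hb
            match t with
            | [] =>
              refine ⟨[], a, hf a (by simp), fun x hx => ?_⟩
              simp only [List.cons_append, List.nil_append]
              rw [contract_merge ha, contract_one (by simp [ha])]
            | c :: r =>
              obtain ⟨γ, d, hd, h⟩ := ih ((a + c) :: r) (by simp at hl ⊢; omega) (by
                intro x hx
                rcases List.mem_cons.mp hx with rfl | hx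
                · have h1 := hf a (by simp)
                  have h2 := hf c (by simp)
                  simp [h1, h2]
                · exact hf x (by simp [hx]))
              refine ⟨γ, d, hd, fun x hx => ?_⟩
              rw [← h x hx]
              simp only [List.cons_append]
              rw [contract_merge ha]
          · obtain ⟨γ, d, hd, h⟩ := ih (b :: t) (by simp at hl ⊢; omega)
              (fun x hx => hf x (List.mem_cons_of_mem _ hx))
            refine ⟨a :: γ, d, hd, fun x hx => ?_⟩
            simp only [List.cons_append] at h ⊢
            rw [contract_cons ha hb, h x hx]

theorem contract_left (n : ℕ) : ∀ l : List ℕ∞, l.length ≤ n → (∀ a ∈ l, a ≠ ⊤) →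
    ∃ (γ : List ℕ∞) (c : ℕ∞), c ≠ ⊤ ∧ ∀ x : ℕ∞, x ≠ 0 → contract (x :: l) = (c + x) :: γ := by
  induction n with
  | zero =>
    intro l hl _
    have : l = [] := List.length_eq_zero_iff.mp (by omega)
    subst this
    exact ⟨[], 0, by simp, fun x hx => by simp [contract_one hx]⟩
  | succ n ih =>
    intro l hl hf
    match l with
    | [] => exact ⟨[], 0, by simp, fun x hx => by simp [contract_one hx]⟩
    | b :: t =>
      by_cases hb : b = 0
      · subst hb
        match t with
        | [] => exact ⟨[], 0, by simp, fun x hx => by simp [contract_two_zero hx]⟩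
        | c :: r =>
          obtain ⟨γ, d, hd, h⟩ := ih r (by simp at hl ⊢; omega) (fun x hx => hf x (by simp [hx]))
          have hc := hf c (by simp)
          refine ⟨γ, d + c, by simp [hd, hc], fun x hx => ?_⟩
          rw [contract_merge hx, h _ (by simp [hx]), add_assoc, add_comm c x]
      · exact ⟨contract (b :: t), 0, by simp, fun x hx => by rw [contract_cons hx hb, zero_add]⟩

/-! Basic facts on P and N positions. -/

theorem PPos.elim {p q : List ℕ∞} (h : PPos p) (hm : Move p q) : NPos q := by
  cases h with
  | mk _ opt h1 h2 => exact ⟨opt q hm, h1 q hm, h2 q hm⟩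

theorem PPos.intro {p : List ℕ∞} (h : ∀ q, Move p q → NPos q) : PPos p :=
  PPos.mk p (fun q hq => (h q hq).choose) (fun q hq => (h q hq).choose_spec.1)
    (fun q hq => (h q hq).choose_spec.2)

theorem PPos.not_NPos {p : List ℕ∞} (h : PPos p) : ¬ NPos p := by
  induction h with
  | mk p opt h1 h2 ih =>
    rintro ⟨q, hm, hq⟩
    exact ih q hm (hq.elim (h1 q hm))

theorem Move.sum_lt {p q : List ℕ∞} (hp : p.sum ≠ ⊤) (h : Move p q) : q.sum < p.sum := by
  unfold Move premove at h
  rw [← contract_sum p] at hp ⊢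
  rcases h with ⟨a, t, a', h1, h2, rfl⟩ | ⟨a, t, a', h1, h2, rfl⟩ |
    ⟨α, a, b, β, k, h1, h2, h3, h4, h5, rfl⟩ | ⟨α, β, k, h1, h2⟩
  · rw [h1] at hp ⊢
    rw [contract_sum]
    simp only [List.sum_cons] at hp ⊢
    generalize t.sum = s at *
    have hs : s ≠ ⊤ := by rintro rfl; simp at hp
    exact (ENat.add_lt_add_iff_right hs).mpr h2
  · rw [h1] at hp ⊢
    rw [contract_sum]
    simp only [List.sum_append, List.sum_cons, List.sum_nil, add_zero] at hp ⊢
    generalize t.sum = s at *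
    have hs : s ≠ ⊤ := by rintro rfl; simp at hp
    exact (ENat.add_lt_add_iff_left hs).mpr h2
  · rw [h1] at hp ⊢
    rw [contract_sum]
    simp only [List.sum_append, List.sum_cons] at hp ⊢
    generalize α.sum = s at *
    generalize β.sum = t at *
    simp only [ne_eq, ENat.add_eq_top, not_or] at hp
    obtain ⟨hs, ha, hb, ht⟩ := hp
    lift a to ℕ using ha
    lift b to ℕ using hb
    lift s to ℕ using hs
    lift t to ℕ using ht
    norm_cast at *
    omega
  · rw [h1] at hp
    simp at hp

theorem PPos_or_NPos (n : ℕ) : ∀ p : List ℕ∞, p.sum < n → PPos p ∨ NPos p := by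
  induction n with
  | zero => intro p hp; simp at hp
  | succ n ih =>
    intro p hp
    by_cases h : NPos p
    · exact Or.inr h
    · left
      apply PPos.intro
      intro q hq
      have hlt := Move.sum_lt (ne_top_of_lt hp) hq
      have h3 : p.sum ≤ n := by
        push_cast at hp
        exact Order.le_of_lt_add_one hp
      rcases ih q (lt_of_lt_of_le hlt h3) with h' | h'
      · exact absurd ⟨q, hq, h'⟩ h
      · exact h'

theorem PPos_or_NPos_of_finite (p : List ℕ∞) (h : ∀ a ∈ p, a ≠ ⊤) : PPos p ∨ NPos p := by
  have hs : p.sum ≠ ⊤ := by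
    induction p with
    | nil => simp
    | cons a t ih =>
      have h1 := h a (by simp)
      have h2 := ih (fun x hx => h x (by simp [hx]))
      simp [h1, h2]
  obtain ⟨n, hn⟩ := ENat.ne_top_iff_exists.mp hs
  refine PPos_or_NPos (n + 1) p ?_
  rw [← hn]
  exact_mod_cast Nat.lt_succ_self n

theorem unique_right (β : List ℕ∞) (hβ : ∀ a ∈ β, a ≠ ⊤) (x y : ℕ) (hx : 0 < x) (hxy : x < y)
    (h1 : PPos (contract (β ++ [(x : ℕ∞)]))) (h2 : PPos (contract (β ++ [(y : ℕ∞)]))) : False := by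
  obtain ⟨γ, c, hc, h⟩ := contract_right β.length β le_rfl hβ
  apply h2.not_NPos
  refine ⟨_, ?_, h1⟩
  unfold Move
  rw [contract_idem, ← contract_idem (β ++ [(x : ℕ∞)]), h x (by exact_mod_cast hx.ne'),
    h y (by exact_mod_cast (hx.trans hxy).ne')]
  exact Or.inr (Or.inl ⟨c + y, γ, c + x, rfl,
    (ENat.add_lt_add_iff_left hc).mpr (by exact_mod_cast hxy), rfl⟩)

theorem unique_left (β : List ℕ∞) (hβ : ∀ a ∈ β, a ≠ ⊤) (x y : ℕ) (hx : 0 < x) (hxy : x < y)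
    (h1 : PPos (contract ((x : ℕ∞) :: β))) (h2 : PPos (contract ((y : ℕ∞) :: β))) : False := by
  obtain ⟨γ, c, hc, h⟩ := contract_left β.length β le_rfl hβ
  apply h2.not_NPos
  refine ⟨_, ?_, h1⟩
  unfold Move
  rw [contract_idem, ← contract_idem ((x : ℕ∞) :: β), h x (by exact_mod_cast hx.ne'),
    h y (by exact_mod_cast (hx.trans hxy).ne')]
  exact Or.inl ⟨c + y, γ, c + x, rfl,
    (ENat.add_lt_add_iff_left hc).mpr (by exact_mod_cast hxy), rfl⟩

theorem finite_below (α : List ℕ∞) (hα : ∀ a ∈ α, a ≠ ⊤) :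
    {β : List ℕ∞ | List.Forall₂ (· ≤ ·) β α}.Finite := by
  induction α with
  | nil =>
    apply (Set.finite_singleton ([] : List ℕ∞)).subset
    intro β hβ
    simpa using hβ
  | cons a t ih =>
    have h1 : (Set.Iic a).Finite := by
      obtain ⟨n, rfl⟩ := ENat.ne_top_iff_exists.mp (hα a (by simp))
      apply ((Set.finite_Iic n).image (fun k : ℕ => (k : ℕ∞))).subset
      intro x hx
      obtain ⟨m, rfl⟩ := ENat.ne_top_iff_exists.mp
        (ne_top_of_le_ne_top (ENat.natCast_ne_top n) hx)
      exact ⟨m, by simpa using hx, rfl⟩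
    apply (Set.Finite.image2 List.cons h1 (ih (fun x hx => hα x (by simp [hx])))).subset
    intro β hβ
    rcases List.forall₂_cons_right_iff.mp hβ with ⟨b, u, h2, h3, rfl⟩
    exact ⟨b, h2, u, h3, rfl⟩

theorem below_finite {α β : List ℕ∞} (h : List.Forall₂ (· ≤ ·) β α) (hα : ∀ a ∈ α, a ≠ ⊤) :
    ∀ b ∈ β, b ≠ ⊤ := by
  induction h with
  | nil => simp
  | cons h1 _ ih =>
    intro b hb
    rcases List.mem_cons.mp hb with rfl | hb
    · exact ne_top_of_le_ne_top (hα _ (by simp)) h1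
    · exact ih (fun x hx => hα x (by simp [hx])) b hb

theorem exists_bound (α : List ℕ∞) (hα : ∀ a ∈ α, a ≠ ⊤) : ∃ N : ℕ, ∀ a ∈ α, a ≤ N := by
  induction α with
  | nil => exact ⟨0, by simp⟩
  | cons a t ih =>
    obtain ⟨N, hN⟩ := ih (fun x hx => hα x (by simp [hx]))
    obtain ⟨n, rfl⟩ := ENat.ne_top_iff_exists.mp (hα a (by simp))
    refine ⟨n + N, fun x hx => ?_⟩
    rcases List.mem_cons.mp hx with rfl | hx
    · exact_mod_cast Nat.le_add_right n N
    · exact (hN x hx).trans (by exact_mod_cast Nat.le_add_left N n)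

/-- The pigeonhole argument, in a form common to both ends. -/
theorem pigeonhole (α : List ℕ∞) (hα : ∀ a ∈ α, a ≠ ⊤) (N : ℕ) (f : List ℕ∞ → ℕ → List ℕ∞)
    (hu : ∀ β : List ℕ∞, (∀ a ∈ β, a ≠ ⊤) → ∀ x y : ℕ, 0 < x → x < y →
      PPos (f β x) → PPos (f β y) → False)
    (h : ∀ x : ℕ, N < x → ∃ (β : List ℕ∞) (k : ℕ), List.Forall₂ (· ≤ ·) β α ∧ k ≤ N ∧
      PPos (f β (x - k))) : False := by
  choose! B K h1 h2 h3 using h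
  have hfin := (finite_below α hα).prod (Set.finite_Iic N)
  have hmaps : Set.MapsTo (fun x => (B x, K x)) (Set.Ioi N)
      ({β : List ℕ∞ | List.Forall₂ (· ≤ ·) β α} ×ˢ Set.Iic N) :=
    fun x hx => ⟨h1 x hx, h2 x hx⟩
  have key : ∀ x y : ℕ, N < x → x < y → B x = B y → K x = K y → False := by
    intro x y hx hxy hB hK
    have e1 := h3 x hx
    have e2 := h3 y (hx.trans hxy)
    have e3 := h2 x hx
    rw [← hB, ← hK] at e2
    exact hu (B x) (below_finite (h1 x hx) hα) (x - K x) (y - K x) (by omega) (by omega) e1 e2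
  obtain ⟨x, hx, y, hy, hne, he⟩ :=
    (Set.Ioi_infinite N).exists_ne_map_eq_of_mapsTo hmaps hfin
  have hB : B x = B y := congrArg Prod.fst he
  have hK : K x = K y := congrArg Prod.snd he
  rcases lt_or_gt_of_ne hne with hlt | hlt
  · exact key x y hx hlt hB hK
  · exact key y x hy hlt hB.symm hK.symm

theorem forall₂_refl (α : List ℕ∞) : List.Forall₂ (· ≤ ·) α α :=
  List.forall₂_same.mpr (fun _ _ => le_rfl)

theorem exists_right (α : List ℕ∞) (h0 : ∀ a ∈ α, a ≠ 0) (hα : ∀ a ∈ α, a ≠ ⊤) :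
    ∃ x : ℕ, PPos (contract (α ++ [(x : ℕ∞)])) := by
  by_contra! hno
  obtain ⟨N, hN⟩ := exists_bound α hα
  refine pigeonhole α hα N (fun β x => contract (β ++ [(x : ℕ∞)])) unique_right ?_
  intro x hx
  have hc : contract (α ++ [(x : ℕ∞)]) = α ++ [(x : ℕ∞)] := by
    apply contract_of_ne
    intro a ha
    rcases List.mem_append.mp ha with ha | ha
    · exact h0 a ha
    · rw [List.mem_singleton.mp ha]
      exact_mod_cast (show x ≠ 0 by omega)
  have hfin : ∀ a ∈ α ++ [(x : ℕ∞)], a ≠ ⊤ := by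
    intro a ha
    rcases List.mem_append.mp ha with ha | ha
    · exact hα a ha
    · rw [List.mem_singleton.mp ha]
      exact ENat.natCast_ne_top x
  have hlast : ∀ a' : ℕ∞, a' < x → PPos (contract (α ++ [a'])) → False := by
    intro a' ha' hP
    lift a' to ℕ using ne_top_of_lt ha'
    exact hno _ hP
  have hn := hno x
  rw [hc] at hn
  obtain ⟨q, hm, hq⟩ := (PPos_or_NPos_of_finite _ hfin).resolve_left hn
  unfold Move at hm
  rw [hc] at hm
  rcases hm with ⟨a, t, a', e1, e2, rfl⟩ | ⟨a, t, a', e1, e2, rfl⟩ |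
    ⟨γ, a, b, δ, k, e1, e2, e3, e4, e5, rfl⟩ | ⟨γ, δ, k, e1, e2⟩
  · cases α with
    | nil =>
      simp only [List.nil_append, List.cons.injEq] at e1
      obtain ⟨rfl, rfl⟩ := e1
      exact (hlast a' e2 hq).elim
    | cons c α =>
      simp only [List.cons_append, List.cons.injEq] at e1
      obtain ⟨rfl, rfl⟩ := e1
      exact ⟨a' :: α, 0, List.Forall₂.cons e2.le (forall₂_refl α), Nat.zero_le _, hq⟩
  · obtain ⟨rfl, h'⟩ := List.append_inj' e1 rfl
    simp only [List.cons.injEq, and_true] at h'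
    subst h'
    exact (hlast a' e2 hq).elim
  · rcases List.eq_nil_or_concat δ with rfl | ⟨δ, z, rfl⟩
    · have e1' : α ++ [(x : ℕ∞)] = (γ ++ [a]) ++ [b] := by simpa using e1
      obtain ⟨rfl, h'⟩ := List.append_inj' e1' rfl
      simp only [List.cons.injEq, and_true] at h'
      subst h'
      refine ⟨γ ++ [a - k], k, ?_, ?_, ?_⟩
      · exact List.rel_append (forall₂_refl γ) (List.Forall₂.cons tsub_le_self List.Forall₂.nil)
      · exact_mod_cast e3.trans (hN a (by simp))
      · simpa using hq
    · have e1' : α ++ [(x : ℕ∞)] = (γ ++ a :: b :: δ) ++ [z] := by simpa using e1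
      obtain ⟨rfl, h'⟩ := List.append_inj' e1' rfl
      simp only [List.cons.injEq, and_true] at h'
      subst h'
      refine ⟨γ ++ (a - k) :: (b - k) :: δ, 0, ?_, Nat.zero_le _, ?_⟩
      · exact List.rel_append (forall₂_refl γ)
          (List.Forall₂.cons tsub_le_self (List.Forall₂.cons tsub_le_self (forall₂_refl δ)))
      · simpa using hq
  · exact (hfin ⊤ (by rw [e1]; simp) rfl).elim

theorem exists_left (α : List ℕ∞) (h0 : ∀ a ∈ α, a ≠ 0) (hα : ∀ a ∈ α, a ≠ ⊤) :
    ∃ x : ℕ, PPos (contract ((x : ℕ∞) :: α)) := by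
  by_contra! hno
  obtain ⟨N, hN⟩ := exists_bound α hα
  refine pigeonhole α hα N (fun β x => contract ((x : ℕ∞) :: β)) unique_left ?_
  intro x hx
  have hc : contract ((x : ℕ∞) :: α) = (x : ℕ∞) :: α := by
    apply contract_of_ne
    intro a ha
    rcases List.mem_cons.mp ha with rfl | ha
    · exact_mod_cast (show x ≠ 0 by omega)
    · exact h0 a ha
  have hfin : ∀ a ∈ (x : ℕ∞) :: α, a ≠ ⊤ := by
    intro a ha
    rcases List.mem_cons.mp ha with rfl | ha
    · exact ENat.natCast_ne_top x
    · exact hα a ha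
  have hlast : ∀ a' : ℕ∞, a' < x → PPos (contract (a' :: α)) → False := by
    intro a' ha' hP
    lift a' to ℕ using ne_top_of_lt ha'
    exact hno _ hP
  have hn := hno x
  rw [hc] at hn
  obtain ⟨q, hm, hq⟩ := (PPos_or_NPos_of_finite _ hfin).resolve_left hn
  unfold Move at hm
  rw [hc] at hm
  rcases hm with ⟨a, t, a', e1, e2, rfl⟩ | ⟨a, t, a', e1, e2, rfl⟩ |
    ⟨γ, a, b, δ, k, e1, e2, e3, e4, e5, rfl⟩ | ⟨γ, δ, k, e1, e2⟩
  · simp only [List.cons.injEq] at e1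
    obtain ⟨rfl, rfl⟩ := e1
    exact (hlast a' e2 hq).elim
  · cases t with
    | nil =>
      simp only [List.nil_append, List.cons.injEq] at e1
      obtain ⟨rfl, rfl⟩ := e1
      exact (hlast a' e2 hq).elim
    | cons c t =>
      simp only [List.cons_append, List.cons.injEq] at e1
      obtain ⟨rfl, rfl⟩ := e1
      exact ⟨t ++ [a'], 0, List.rel_append (forall₂_refl t)
        (List.Forall₂.cons e2.le List.Forall₂.nil), Nat.zero_le _, hq⟩
  · cases γ with
    | nil =>
      simp only [List.nil_append, List.cons.injEq] at e1
      obtain ⟨rfl, rfl⟩ := e1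
      refine ⟨(b - k) :: δ, k, ?_, ?_, ?_⟩
      · exact List.Forall₂.cons tsub_le_self (forall₂_refl δ)
      · exact_mod_cast e4.trans (hN b (by simp))
      · simpa using hq
    | cons c γ =>
      simp only [List.cons_append, List.cons.injEq] at e1
      obtain ⟨rfl, rfl⟩ := e1
      refine ⟨γ ++ (a - k) :: (b - k) :: δ, 0, ?_, Nat.zero_le _, ?_⟩
      · exact List.rel_append (forall₂_refl γ)
          (List.Forall₂.cons tsub_le_self (List.Forall₂.cons tsub_le_self (forall₂_refl δ)))
      · simpa using hq
  · exact (hfin ⊤ (by rw [e1]; simp) rfl).elim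

theorem NPos_right (α : List ℕ∞) (h0 : ∀ a ∈ α, a ≠ 0) (hα : ∀ a ∈ α, a ≠ ⊤) :
    NPos (α ++ [⊤]) := by
  obtain ⟨x, hx⟩ := exists_right α h0 hα
  refine ⟨_, ?_, hx⟩
  unfold Move
  rw [contract_of_ne (α ++ [⊤])]
  · exact Or.inr (Or.inl ⟨⊤, α, x, rfl, ENat.natCast_lt_top x, rfl⟩)
  · intro a ha
    rcases List.mem_append.mp ha with ha | ha
    · exact h0 a ha
    · rw [List.mem_singleton.mp ha]; simp

theorem NPos_left (α : List ℕ∞) (h0 : ∀ a ∈ α, a ≠ 0) (hα : ∀ a ∈ α, a ≠ ⊤) :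
    NPos (⊤ :: α) := by
  obtain ⟨x, hx⟩ := exists_left α h0 hα
  refine ⟨_, ?_, hx⟩
  unfold Move
  rw [contract_of_ne (⊤ :: α)]
  · exact Or.inl ⟨⊤, α, x, rfl, ENat.natCast_lt_top x, rfl⟩
  · intro a ha
    rcases List.mem_cons.mp ha with rfl | ha
    · simp
    · exact h0 a ha

theorem PPos_nil : PPos [] := by
  apply PPos.intro
  intro q hq
  unfold Move premove at hq
  rw [contract_nil] at hq
  simp at hq

theorem NPos_top_top : NPos [⊤, ⊤] := by
  refine ⟨[], ?_, PPos_nil⟩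
  unfold Move
  rw [contract_of_ne _ (by simp)]
  refine Or.inr (Or.inr (Or.inr ⟨[], [], 0, rfl, ?_⟩))
  simp [contract_zero, contract_nil]

/-- The position `(∞, a+1, b+1, ∞)`. -/
def pos (a b : ℕ) : List ℕ∞ := [⊤, ((a + 1 : ℕ) : ℕ∞), ((b + 1 : ℕ) : ℕ∞), ⊤]

theorem contract_pos (a b : ℕ) : contract (pos a b) = pos a b := by
  apply contract_of_ne
  simp [pos]

theorem move_pos {a b c d : ℕ} (h : Wythoff.Move (a, b) (c, d)) : Move (pos a b) (pos c d) := by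
  unfold Move
  rw [contract_pos, ← contract_pos c d]
  rcases h with ⟨h1, h2⟩ | ⟨h1, h2⟩ | ⟨k, hk, h1, h2, hq⟩
  · simp only at h1 h2
    subst h2
    refine Or.inr (Or.inr (Or.inl ⟨[], ⊤, (a + 1 : ℕ), [((d + 1 : ℕ) : ℕ∞), ⊤], a - c, rfl,
      by omega, le_top, by exact_mod_cast (by omega), Or.inr (ENat.natCast_ne_top _), ?_⟩))
    have : ((a + 1 : ℕ) : ℕ∞) - ((a - c : ℕ) : ℕ∞) = ((c + 1 : ℕ) : ℕ∞) := by
      rw [← ENat.natCast_sub]; congr 1; omega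
    rw [this, ENat.top_sub_natCast]
    rfl
  · simp only at h1 h2
    subst h1
    refine Or.inr (Or.inr (Or.inl ⟨[⊤, ((c + 1 : ℕ) : ℕ∞)], (b + 1 : ℕ), ⊤, [], b - d, rfl,
      by omega, by exact_mod_cast (by omega), le_top, Or.inl (ENat.natCast_ne_top _), ?_⟩))
    have : ((b + 1 : ℕ) : ℕ∞) - ((b - d : ℕ) : ℕ∞) = ((d + 1 : ℕ) : ℕ∞) := by
      rw [← ENat.natCast_sub]; congr 1; omega
    rw [this, ENat.top_sub_natCast]
    rfl
  · simp only [Prod.mk.injEq] at h1 h2 hq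
    refine Or.inr (Or.inr (Or.inl ⟨[⊤], (a + 1 : ℕ), (b + 1 : ℕ), [⊤], k, rfl,
      hk, by exact_mod_cast (by omega), by exact_mod_cast (by omega),
      Or.inl (ENat.natCast_ne_top _), ?_⟩))
    have e1 : ((a + 1 : ℕ) : ℕ∞) - (k : ℕ∞) = ((c + 1 : ℕ) : ℕ∞) := by
      rw [← ENat.natCast_sub]; congr 1; omega
    have e2 : ((b + 1 : ℕ) : ℕ∞) - (k : ℕ∞) = ((d + 1 : ℕ) : ℕ∞) := by
      rw [← ENat.natCast_sub]; congr 1; omega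
    rw [e1, e2]
    rfl

theorem contract_zero_left (n : ℕ∞) : contract [⊤, 0, n, ⊤] = [⊤, ⊤] := by
  rw [contract_merge (by simp)]
  exact contract_of_ne _ (by simp)

theorem contract_zero_right (n : ℕ) :
    contract [⊤, ((n + 1 : ℕ) : ℕ∞), 0, ⊤] = [⊤, ⊤] := by
  have h : ((n + 1 : ℕ) : ℕ∞) ≠ 0 := by simp
  rw [contract_cons (by simp) h, contract_merge h]
  simp [contract_one]

/-- All options of `(∞, a+1, b+1, ∞)`. -/
theorem of_move_pos {a b : ℕ} {q : List ℕ∞} (h : Move (pos a b) q) :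
    NPos q ∨ ∃ c d, Wythoff.Move (a, b) (c, d) ∧ q = pos c d := by
  unfold Move at h
  rw [contract_pos] at h
  rcases h with ⟨x, t, x', e1, e2, rfl⟩ | ⟨x, t, x', e1, e2, rfl⟩ |
    ⟨γ, x, y, δ, k, e1, e2, e3, e4, e5, rfl⟩ | ⟨γ, δ, k, e1, e2⟩
  · left
    simp only [pos, List.cons.injEq] at e1
    obtain ⟨rfl, rfl⟩ := e1
    lift x' to ℕ using e2.ne
    by_cases hx : x' = 0
    · subst hx
      rw [Nat.cast_zero, contract_zero, contract_of_ne _ (by simp)]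
      exact NPos_right [((a + 1 : ℕ) : ℕ∞), ((b + 1 : ℕ) : ℕ∞)] (by simp)
        (by simp [-Nat.cast_add])
    · rw [contract_of_ne _ (by simp [hx])]
      exact NPos_right [(x' : ℕ∞), ((a + 1 : ℕ) : ℕ∞), ((b + 1 : ℕ) : ℕ∞)] (by simp [hx])
        (by simp [-Nat.cast_add])
  · left
    have e1' : [⊤, ((a + 1 : ℕ) : ℕ∞), ((b + 1 : ℕ) : ℕ∞)] ++ [⊤] = t ++ [x] := e1
    obtain ⟨rfl, h'⟩ := List.append_inj' e1' rfl
    simp only [List.cons.injEq, and_true] at h'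
    subst h'
    lift x' to ℕ using e2.ne
    by_cases hx : x' = 0
    · subst hx
      have hh : contract ([⊤, ((a + 1 : ℕ) : ℕ∞), ((b + 1 : ℕ) : ℕ∞)] ++ [((0 : ℕ) : ℕ∞)])
          = [⊤, ((a + 1 : ℕ) : ℕ∞), ((b + 1 : ℕ) : ℕ∞)] := by
        have h1 : ((a + 1 : ℕ) : ℕ∞) ≠ 0 := by simp
        have h2 : ((b + 1 : ℕ) : ℕ∞) ≠ 0 := by simp
        simp only [List.cons_append, List.nil_append, Nat.cast_zero]
        rw [contract_cons (by simp) h1, contract_cons h1 h2, contract_two_zero h2]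
      rw [hh]
      exact NPos_left [((a + 1 : ℕ) : ℕ∞), ((b + 1 : ℕ) : ℕ∞)] (by simp)
        (by simp [-Nat.cast_add])
    · rw [contract_of_ne _ (by simp [hx])]
      exact NPos_left [((a + 1 : ℕ) : ℕ∞), ((b + 1 : ℕ) : ℕ∞), (x' : ℕ∞)] (by simp [hx])
        (by simp [-Nat.cast_add])
  · have sub : ∀ n : ℕ, k < n + 1 → ((n + 1 : ℕ) : ℕ∞) - (k : ℕ∞) = ((n - k + 1 : ℕ) : ℕ∞) := by
      intro n hn
      rw [← ENat.natCast_sub]; congr 1; omega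
    have sub0 : ∀ n : ℕ, k = n + 1 → ((n + 1 : ℕ) : ℕ∞) - (k : ℕ∞) = 0 := by
      intro n hn
      rw [← ENat.natCast_sub, hn]; simp
    match γ, e1 with
    | [], e1 =>
      simp only [pos, List.nil_append, List.cons.injEq] at e1
      obtain ⟨rfl, rfl, rfl⟩ := e1
      have hk : k ≤ a + 1 := by exact_mod_cast e4
      rw [List.nil_append, ENat.top_sub_natCast]
      rcases hk.lt_or_eq with hk | hk
      · right
        refine ⟨a - k, b, Or.inl ⟨by simp only; omega, rfl⟩, ?_⟩
        rw [sub a hk]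
        exact contract_pos _ _
      · left
        rw [sub0 a hk, contract_zero_left]
        exact NPos_top_top
    | [u], e1 =>
      simp only [pos, List.cons_append, List.nil_append, List.cons.injEq] at e1
      obtain ⟨rfl, rfl, rfl, rfl⟩ := e1
      have hk : k ≤ a + 1 := by exact_mod_cast e3
      have hk' : k ≤ b + 1 := by exact_mod_cast e4
      rw [List.cons_append, List.nil_append]
      rcases hk.lt_or_eq with hk | hk
      · rcases hk'.lt_or_eq with hk' | hk'
        · right
          refine ⟨a - k, b - k, Or.inr (Or.inr ⟨k, e2, by simp only; omega,
            by simp only; omega, rfl⟩), ?_⟩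
          rw [sub a hk, sub b hk']
          exact contract_pos _ _
        · left
          rw [sub a hk, sub0 b hk', contract_zero_right]
          exact NPos_top_top
      · left
        rw [sub0 a hk, contract_zero_left]
        exact NPos_top_top
    | [u, v], e1 =>
      simp only [pos, List.cons_append, List.nil_append, List.cons.injEq] at e1
      obtain ⟨rfl, rfl, rfl, rfl, rfl⟩ := e1
      have hk : k ≤ b + 1 := by exact_mod_cast e3
      rw [List.cons_append, List.cons_append, List.nil_append, ENat.top_sub_natCast]
      rcases hk.lt_or_eq with hk | hk
      · right
        refine ⟨a, b - k, Or.inr (Or.inl ⟨rfl, by simp only; omega⟩), ?_⟩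
        rw [sub b hk]
        exact contract_pos _ _
      · left
        rw [sub0 b hk, contract_zero_right]
        exact NPos_top_top
    | u :: v :: w :: γ, e1 =>
      have := congrArg List.length e1
      simp [pos] at this
      omega
  · exfalso
    match γ, e1 with
    | [], e1 =>
      simp only [pos, List.nil_append, List.cons.injEq] at e1
      exact ENat.natCast_ne_top _ e1.2.1
    | [u], e1 =>
      simp only [pos, List.cons_append, List.nil_append, List.cons.injEq] at e1
      exact ENat.natCast_ne_top _ e1.2.1
    | [u, v], e1 =>
      simp only [pos, List.cons_append, List.nil_append, List.cons.injEq] at e1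
      exact ENat.natCast_ne_top _ e1.2.2.1
    | u :: v :: w :: γ, e1 =>
      have := congrArg List.length e1
      simp [pos] at this
      omega

theorem pos_iff (n : ℕ) : ∀ a b : ℕ, a + b < n → (PPos (pos a b) ↔ Wythoff.PPos (a, b)) := by
  induction n with
  | zero => intro a b h; omega
  | succ n ih =>
    intro a b hab
    have ih' : ∀ c d, Wythoff.Move (a, b) (c, d) → (PPos (pos c d) ↔ Wythoff.PPos (c, d)) := by
      intro c d hm
      have h1 := hm.sum_lt
      simp only at h1
      exact ih c d (by omega)
    constructor
    · intro h
      rw [Wythoff.PPos]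
      rintro ⟨c, d⟩ hm hP
      exact h.not_NPos ⟨pos c d, move_pos hm, (ih' c d hm).mpr hP⟩
    · intro h
      apply PPos.intro
      intro q hq
      rcases of_move_pos hq with hq | ⟨c, d, hm, rfl⟩
      · exact hq
      · rw [Wythoff.PPos] at h
        have hn := h _ hm
        rw [Wythoff.PPos] at hn
        push Not at hn
        obtain ⟨⟨e, f⟩, hm', hP⟩ := hn
        have h1 := hm.sum_lt
        have h2 := hm'.sum_lt
        simp only at h1 h2
        exact ⟨pos e f, move_pos hm', (ih e f (by omega)).mpr hP⟩

end TwystOffInf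

theorem inf_a_b_inf_P_iff_wythoff (a b : ℕ) (ha : 0 < a) (hb : 0 < b) :
    TwystOffInf.PPos [⊤, (a : ℕ∞), (b : ℕ∞), ⊤] ↔ Wythoff.PPos (a - 1, b - 1) := by
  obtain ⟨a, rfl⟩ := Nat.exists_eq_add_of_lt ha
  obtain ⟨b, rfl⟩ := Nat.exists_eq_add_of_lt hb
  have h := TwystOffInf.pos_iff (a + b + 1) a b (by omega)
  simpa [TwystOffInf.pos] using h
end
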